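/- arXiv:2010.08616 — 2 statements merged into one kernel-verified Lean document; each statement's English description precedes it below -/
import Mathlib

section
/- Let G be a finite group and m a positive integer. Suppose that every element g ∈ G has a left Engel sink E(g) of cardinality at most m. Then G has a normal subgroup N of order bounded in terms of m (i.e. |N| ≤ f(m) for a function f depending only on m) such that G/N is nilpotent. -/
/-- The Engel commutator step: `engelComm x g = [x, g] = x⁻¹ g⁻¹ x g`. -/
def engelComm {G : Type*} [Group G] (x g : G) : G := x⁻¹ * g⁻¹ * x * g

/-- `E` is a left Engel sink of `g`: for every `x` all sufficiently long commutators
`[x, g, g, ..., g]` belong to `E`. -/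
def IsLeftEngelSink {G : Type*} [Group G] (g : G) (E : Set G) : Prop :=
  ∀ x : G, ∃ l₀ : ℕ, ∀ l ≥ l₀, (fun y => engelComm y g)^[l] x ∈ E


/-! ## Part 1: minimal sinks -/

/-- The minimal left Engel sink in a finite group: periodic points of `x ↦ [x,g]`. -/
def sk {G : Type*} [Group G] (g : G) : Set G := Function.periodicPts (fun y => engelComm y g)

section Basics
variable {G : Type*} [Group G]

theorem engelComm_one (g : G) : engelComm 1 g = 1 := by simp [engelComm]

theorem one_mem_sk (g : G) : (1 : G) ∈ sk g :=
  ⟨1, one_pos, by simp [Function.IsPeriodicPt, Function.IsFixedPt, engelComm]⟩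

theorem engelComm_eq_one {x g : G} (h : x * g = g * x) : engelComm x g = 1 := by
  simp only [engelComm]
  rw [mul_assoc, h]; group

theorem engelComm_mem_sk {x g : G} (h : x ∈ sk g) : engelComm x g ∈ sk g := by
  obtain ⟨n, hn, hx⟩ := h
  exact ⟨n, hn, hx.apply⟩

theorem eq_one_of_mem_sk_of_comm {x g : G} (h : x ∈ sk g) (hc : x * g = g * x) : x = 1 := by
  obtain ⟨n, hn, hx⟩ := h
  obtain ⟨k, rfl⟩ : ∃ k, n = k + 1 := ⟨n - 1, by omega⟩
  have h1 : ((fun y => engelComm y g)^[k + 1]) x = x := hx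
  rw [Function.iterate_succ_apply] at h1
  simp only [engelComm_eq_one hc] at h1
  rw [← h1]
  exact Function.iterate_fixed (engelComm_one g) k

theorem sk_subset_sink {g : G} {E : Set G} (hE : IsLeftEngelSink g E) : sk g ⊆ E := by
  rintro x ⟨n, hn, hx⟩
  obtain ⟨l, hl⟩ := hE x
  have := hl (n * l) (by nlinarith)
  rwa [(hx.mul_const l : _)] at this

theorem exists_iter_mem_sk [Finite G] (g x : G) :
    ∃ l₀ : ℕ, ∀ l ≥ l₀, (fun y => engelComm y g)^[l] x ∈ sk g := by
  obtain ⟨i, j, hij, h⟩ := Finite.exists_ne_map_eq_of_infinite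
    (fun n : ℕ => (fun y => engelComm y g)^[n] x)
  have key : ∀ i j : ℕ, i < j → (fun y => engelComm y g)^[i] x = (fun y => engelComm y g)^[j] x →
      ∃ l₀ : ℕ, ∀ l ≥ l₀, (fun y => engelComm y g)^[l] x ∈ sk g := by
    intro i j hij h
    have h0 : (fun y => engelComm y g)^[i] x ∈ sk g := by
      refine ⟨j - i, by omega, ?_⟩
      change (fun y => engelComm y g)^[j - i] _ = _
      rw [← Function.iterate_add_apply, Nat.sub_add_cancel hij.le, h]
    refine ⟨i, fun l hl => ?_⟩
    induction l, hl using Nat.le_induction with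
    | base => exact h0
    | succ k _ ih => rw [Function.iterate_succ_apply']; exact engelComm_mem_sk ih
  rcases lt_or_gt_of_ne hij with hl | hl
  · exact key i j hl h
  · exact key j i hl h.symm

theorem map_engel_iter {H : Type*} [Group H] (f : G →* H) (g x : G) (n : ℕ) :
    f ((fun y => engelComm y g)^[n] x) = (fun y => engelComm y (f g))^[n] (f x) := by
  induction n with
  | zero => rfl
  | succ k ih => rw [Function.iterate_succ_apply', Function.iterate_succ_apply', ← ih]; simp [engelComm]

theorem map_mem_sk {H : Type*} [Group H] (f : G →* H) {g x : G} (h : x ∈ sk g) :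
    f x ∈ sk (f g) := by
  obtain ⟨n, hn, hx⟩ := h
  refine ⟨n, hn, ?_⟩
  change (fun y => engelComm y (f g))^[n] (f x) = f x
  rw [← map_engel_iter, hx]

theorem exists_mem_sk_of_map [Finite G] {H : Type*} [Group H] (f : G →* H)
    (hf : Function.Surjective f) {g : G} {y : H} (h : y ∈ sk (f g)) : ∃ x ∈ sk g, f x = y := by
  obtain ⟨n, hn, hy⟩ := h
  obtain ⟨x, rfl⟩ := hf y
  obtain ⟨l, hl⟩ := exists_iter_mem_sk g x
  refine ⟨_, hl (n * l) (by nlinarith), ?_⟩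
  rw [map_engel_iter]
  exact hy.mul_const l

theorem sk_map_ncard [Finite G] {H : Type*} [Group H] (f : G →* H)
    (hf : Function.Surjective f) (g : G) : (sk (f g)).ncard ≤ (sk g).ncard := by
  have : sk (f g) ⊆ f '' sk g := fun y hy => exists_mem_sk_of_map f hf hy
  exact (Set.ncard_le_ncard this (Set.toFinite _)).trans (Set.ncard_image_le (Set.toFinite _))

theorem conj_mem_sk {g x c : G} (h : x ∈ sk g) : c * x * c⁻¹ ∈ sk (c * g * c⁻¹) := by
  simpa using map_mem_sk (MulAut.conj c).toMonoidHom h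

theorem conj_mem_sk_of_comm {g x c : G} (h : x ∈ sk g) (hc : c * g = g * c) :
    c * x * c⁻¹ ∈ sk g := by
  have := conj_mem_sk (c := c) h
  rwa [hc, mul_inv_cancel_right] at this

theorem iter_congr_sk {a d : G} {S : Set G} (hS : ∀ e ∈ S, engelComm e a ∈ S)
    (h : ∀ e ∈ S, engelComm e d = engelComm e a) (n : ℕ) (e : G) (he : e ∈ S) :
    (fun y => engelComm y d)^[n] e = (fun y => engelComm y a)^[n] e := by
  induction n generalizing e with
  | zero => rfl
  | succ k ih =>
    rw [Function.iterate_succ_apply, Function.iterate_succ_apply]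
    simp only [h e he]
    exact ih _ (hS e he)

theorem sk_subset_of_agree {a d : G} (h : ∀ e ∈ sk a, engelComm e d = engelComm e a) :
    sk a ⊆ sk d := by
  intro e he
  obtain ⟨n, hn, hx⟩ := id he
  refine ⟨n, hn, ?_⟩
  change _ = _
  rw [iter_congr_sk (fun e he => engelComm_mem_sk he) h n e he]
  exact hx

theorem sk_subset_mul_right {a b : G} (h : b ∈ Subgroup.centralizer (sk a)) :
    sk a ⊆ sk (a * b) := by
  rw [Subgroup.mem_centralizer_iff] at h
  refine sk_subset_of_agree fun e he => ?_
  have h1 := h _ (engelComm_mem_sk he)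
  have h2 := h e he
  have h3 : engelComm e (a * b) = b⁻¹ * (b * e⁻¹ * b⁻¹) * (a⁻¹ * e * a) * b := by
    have : b * e⁻¹ * b⁻¹ = e⁻¹ := by
      rw [mul_inv_eq_iff_eq_mul, eq_inv_mul_iff_mul_eq, ← mul_assoc, h2, mul_inv_cancel_right]
    simp only [engelComm]
    have h4 : e⁻¹ * b⁻¹ = b⁻¹ * e⁻¹ := by rw [← mul_inv_rev, ← mul_inv_rev, h2]
    rw [this, ← h4]; group
  have h5 : b * e⁻¹ * b⁻¹ = e⁻¹ := by
    rw [mul_inv_eq_iff_eq_mul, eq_inv_mul_iff_mul_eq, ← mul_assoc, h2, mul_inv_cancel_right]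
  rw [h3, h5]
  have : b⁻¹ * e⁻¹ * (a⁻¹ * e * a) * b = b⁻¹ * (engelComm e a * b) := by simp [engelComm]; group
  rw [this, h1]; group

theorem sk_subset_mul_left {a b : G} (h : a ∈ Subgroup.centralizer (sk b)) :
    sk b ⊆ sk (a * b) := by
  rw [Subgroup.mem_centralizer_iff] at h
  refine sk_subset_of_agree fun e he => ?_
  have h2 := h e he
  simp only [engelComm]
  have : a⁻¹ * e * a = e := by rw [mul_assoc, h2]; group
  calc e⁻¹ * (a * b)⁻¹ * e * (a * b) = e⁻¹ * b⁻¹ * (a⁻¹ * e * a) * b := by group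
    _ = _ := by rw [this]

/-- The index bound for the pointwise centralizer of a finite stable set. -/
theorem relIndex_centralizer_le [Finite G] (B : Subgroup G) (S : Set G) (m : ℕ)
    (hm : S.ncard ≤ m) (h : ∀ b ∈ B, ∀ e ∈ S, b * e * b⁻¹ ∈ S) :
    (Subgroup.centralizer S).relIndex B ≤ m ^ m := by
  classical
  rw [Subgroup.relIndex, Subgroup.index]
  let F : (B ⧸ (Subgroup.centralizer S).subgroupOf B) → (S → S) := fun q e =>
    ⟨(q.out : G) * e * (q.out : G)⁻¹, h _ q.out.2 _ e.2⟩
  have hF : Function.Injective F := by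
    intro q r hqr
    rw [← QuotientGroup.out_eq' q, ← QuotientGroup.out_eq' r, QuotientGroup.eq,
      Subgroup.mem_subgroupOf, Subgroup.mem_centralizer_iff]
    intro e he
    have h1 : (q.out : G) * e * (q.out : G)⁻¹ = (r.out : G) * e * (r.out : G)⁻¹ :=
      congrArg Subtype.val (congrFun hqr ⟨e, he⟩)
    push_cast
    rw [mul_inv_eq_iff_eq_mul] at h1
    rw [mul_assoc, eq_inv_mul_iff_mul_eq, ← mul_assoc, ← mul_assoc, h1]
    group
  have := Nat.card_le_card_of_injective F hF
  rw [Nat.card_fun, Nat.card_coe_set_eq] at this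
  exact this.trans ((Nat.pow_le_pow_left hm _).trans (by
    rcases Nat.eq_zero_or_pos m with h0 | h0
    · subst h0; simp at hm; simp [hm]
    · exact Nat.pow_le_pow_right h0 hm))

end Basics

/-! ## Part 2: bounds for abelian subgroups -/

section AbelianBound

theorem relIndex_ne0 {G : Type*} [Group G] [Finite G] (H K : Subgroup G) : H.relIndex K ≠ 0 :=
  Subgroup.index_ne_zero_of_finite

theorem abelian_step {G : Type*} [Group G] [Finite G] (m : ℕ) (hm : ∀ g : G, (sk g).ncard ≤ m)
    (A : Subgroup G) (hA : ∀ a ∈ A, ∀ b ∈ A, a * b = b * a)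
    (h1 : ∀ a ∈ A, (∀ e ∈ sk a, e = 1) → a = 1) (k : ℕ) :
    ∀ B : Subgroup G, B ≤ A → (m ^ m) ^ k < Nat.card B →
      ∃ b ∈ B, b ≠ 1 ∧ 2 ^ k ≤ (Subgroup.centralizer (sk b)).relIndex B := by
  induction k with
  | zero =>
    intro B hB hc
    rw [pow_zero] at hc
    obtain ⟨b, hb1⟩ := Subgroup.ne_bot_iff_exists_ne_one.1
      (show B ≠ ⊥ by rintro rfl; simp at hc)
    exact ⟨b, b.2, by simpa using hb1, Nat.one_le_iff_ne_zero.2 (relIndex_ne0 _ _)⟩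
  | succ k ih =>
    intro B hB hc
    obtain ⟨a, haB, hmax⟩ := Set.exists_max_image (B : Set G) (fun a => (sk a).ncard)
      (Set.toFinite _) ⟨1, B.one_mem⟩
    have haB : a ∈ B := haB
    set C := Subgroup.centralizer (sk a) with hC
    set B1 := B ⊓ C with hB1
    have hidx : C.relIndex B ≤ m ^ m := by
      refine relIndex_centralizer_le B (sk a) m (hm a) fun b hb e he => ?_
      exact conj_mem_sk_of_comm he (hA b (hB hb) a (hB haB))
    have hcard : Nat.card B1 * C.relIndex B = Nat.card B := by
      have := Subgroup.relIndex_mul_relIndex ⊥ B1 B bot_le inf_le_left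
      rwa [Subgroup.relIndex_bot_left, Subgroup.relIndex_bot_left, hB1, Subgroup.inf_relIndex_left] at this
    have hB1c : (m ^ m) ^ k < Nat.card B1 := by
      by_contra hcon
      push Not at hcon
      have := Nat.mul_le_mul hcon hidx
      rw [hcard, ← pow_succ] at this
      omega
    obtain ⟨b, hb, hb1, hbi⟩ := ih B1 (inf_le_left.trans hB) hB1c
    refine ⟨b, hb.1, hb1, ?_⟩
    set D := Subgroup.centralizer (sk b) with hD
    let J : Subgroup G :=
      { carrier := {x | ∃ d ∈ B ⊓ D, ∃ c ∈ B1, x = d * c}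
        one_mem' := ⟨1, one_mem _, 1, one_mem _, by simp⟩
        mul_mem' := by
          rintro _ _ ⟨d, hd, c, hc, rfl⟩ ⟨d', hd', c', hc', rfl⟩
          refine ⟨d * d', mul_mem hd hd', c * c', mul_mem hc hc', ?_⟩
          have := hA c (hB hc.1) d' (hB hd'.1)
          calc d * c * (d' * c') = d * (c * d') * c' := by group
            _ = _ := by rw [this]; group
        inv_mem' := by
          rintro _ ⟨d, hd, c, hc, rfl⟩
          refine ⟨d⁻¹, inv_mem hd, c⁻¹, inv_mem hc, ?_⟩
          rw [hA d (hB hd.1) c (hB hc.1), mul_inv_rev] }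
    have hJB : J ≤ B := by
      rintro _ ⟨d, hd, c, hc, rfl⟩
      exact mul_mem hd.1 hc.1
    have hDJ : B ⊓ D ≤ J := fun d hd => ⟨d, hd, 1, one_mem _, by simp⟩
    have hB1J : B1 ≤ J := fun c hc => ⟨1, one_mem _, c, hc, by simp⟩
    have haJ : a ∉ J := by
      rintro ⟨d, hd, c, hc, hadc⟩
      have hd' : d = a * c⁻¹ := by rw [hadc]; group
      have s1 : sk a ⊆ sk d := by
        rw [hd']; exact sk_subset_mul_right (inv_mem hc.2)
      have e1 : sk a = sk d := Set.eq_of_subset_of_ncard_le s1 (hmax d hd.1) (Set.toFinite _)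
      have s2 : sk d ⊆ sk (d * b) := by
        apply sk_subset_mul_right
        rw [← e1]; exact hb.2
      have s3 : sk b ⊆ sk (d * b) := sk_subset_mul_left hd.2
      have e2 : sk d = sk (d * b) := Set.eq_of_subset_of_ncard_le s2
        (by rw [← e1]; exact hmax _ (mul_mem hd.1 hb.1)) (Set.toFinite _)
      apply hb1
      apply h1 b (hB hb.1)
      intro e he
      apply eq_one_of_mem_sk_of_comm he
      have : e ∈ sk a := by rw [e1, e2]; exact s3 he
      exact (Subgroup.mem_centralizer_iff.1 hb.2) e this
    have i1 : 2 ^ k ≤ (B ⊓ D).relIndex J := by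
      have h2 : D.relIndex B1 = (B ⊓ D).relIndex B1 := by
        rw [← Subgroup.inf_relIndex_right, ← Subgroup.inf_relIndex_right (B ⊓ D)]
        congr 1
        ext x; simp only [Subgroup.mem_inf, hB1]; tauto
      rw [h2] at hbi
      exact hbi.trans (Subgroup.relIndex_le_of_le_right hB1J (relIndex_ne0 _ _))
    have i2 : 2 ≤ J.relIndex B := by
      have h0 : J.relIndex B ≠ 0 := (relIndex_ne0 _ _)
      have h1 : J.relIndex B ≠ 1 := fun h => haJ ((Subgroup.relIndex_eq_one.1 h) haB)
      omega
    have := Subgroup.relIndex_mul_relIndex (B ⊓ D) J B hDJ hJB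
    rw [Subgroup.inf_relIndex_left] at this
    rw [← this, pow_succ]
    exact Nat.mul_le_mul i1 i2

theorem abelian_bound {G : Type*} [Group G] [Finite G] (m : ℕ) (hm : ∀ g : G, (sk g).ncard ≤ m)
    (A : Subgroup G) (hA : ∀ a ∈ A, ∀ b ∈ A, a * b = b * a)
    (h1 : ∀ a ∈ A, (∀ e ∈ sk a, e = 1) → a = 1) : Nat.card A ≤ (m ^ m) ^ (m ^ m) := by
  by_contra hcon
  push Not at hcon
  obtain ⟨b, hb, -, h2⟩ := abelian_step m hm A hA h1 (m ^ m) A le_rfl hcon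
  have hidx : (Subgroup.centralizer (sk b)).relIndex A ≤ m ^ m := by
    refine relIndex_centralizer_le A (sk b) m (hm b) fun c hc e he => ?_
    exact conj_mem_sk_of_comm he (hA c hc b hb)
  have := Nat.lt_two_pow_self (n := m ^ m)
  omega

/-- A finite nilpotent group whose abelian subgroups have order at most `f` is bounded. -/
theorem nilpotent_card_bound {P : Type*} [Group P] [Finite P] [Group.IsNilpotent P] (f : ℕ)
    (hf : ∀ A : Subgroup P, (∀ a ∈ A, ∀ b ∈ A, a * b = b * a) → Nat.card A ≤ f) :
    Nat.card P ≤ f * f ^ f := by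
  obtain ⟨A, ⟨hAn, hAa⟩, hAmax⟩ := Set.exists_max_image
    {A : Subgroup P | A.Normal ∧ ∀ a ∈ A, ∀ b ∈ A, a * b = b * a} (fun A => Nat.card A)
    (Set.toFinite _) ⟨⊥, inferInstance, by simp⟩
  have hAC : Subgroup.centralizer (A : Set P) ≤ A := by
    have key : ∀ i, Subgroup.upperCentralSeries P i ⊓ Subgroup.centralizer (A : Set P) ≤ A := by
      intro i
      induction i with
      | zero => simp
      | succ i ih =>
        rintro x ⟨hx1, hx2⟩
        have hxc := Subgroup.mem_centralizer_iff.1 hx2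
        have hcomm : ∀ g : P, x * g * x⁻¹ * g⁻¹ ∈ A := by
          intro g
          refine ih ⟨Subgroup.mem_upperCentralSeries_succ_iff.1 hx1 g, ?_⟩
          have hN : (Subgroup.centralizer (A : Set P)).Normal := inferInstance
          have := mul_mem hx2 (hN.conj_mem _ (inv_mem hx2) g)
          simpa [mul_assoc] using this
        let B : Subgroup P :=
          { carrier := {y | ∃ a ∈ A, ∃ n : ℤ, y = a * x ^ n}
            one_mem' := ⟨1, one_mem _, 0, by simp⟩
            mul_mem' := by
              rintro _ _ ⟨a, ha, n, rfl⟩ ⟨b, hb, k, rfl⟩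
              refine ⟨a * b, mul_mem ha hb, n + k, ?_⟩
              have : Commute (x ^ n) b := ((show Commute x b from (hxc b hb).symm).zpow_left n)
              rw [zpow_add]
              calc a * x ^ n * (b * x ^ k) = a * (x ^ n * b) * x ^ k := by group
                _ = _ := by rw [this.eq]; group
            inv_mem' := by
              rintro _ ⟨a, ha, n, rfl⟩
              refine ⟨a⁻¹, inv_mem ha, -n, ?_⟩
              have : Commute (x ^ n) a := ((show Commute x a from (hxc a ha).symm).zpow_left n)
              rw [← this.eq, mul_inv_rev, zpow_neg] }
        have hBA : A ≤ B := fun a ha => ⟨a, ha, 0, by simp⟩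
        have hxB : x ∈ B := ⟨1, one_mem _, 1, by simp⟩
        have hBab : ∀ a ∈ B, ∀ b ∈ B, a * b = b * a := by
          rintro _ ⟨a, ha, n, rfl⟩ _ ⟨b, hb, k, rfl⟩
          have c1 : Commute x a := (hxc a ha).symm
          have c2 : Commute x b := (hxc b hb).symm
          have c3 : Commute a b := hAa a ha b hb
          refine Commute.eq ?_
          refine Commute.mul_left (Commute.mul_right c3 (c1.zpow_left k).symm)
            (Commute.mul_right (c2.zpow_left n) ?_)
          exact (Commute.refl x).zpow_zpow n k
        have hBn : B.Normal := by
          refine ⟨?_⟩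
          rintro _ ⟨a, ha, n, rfl⟩ g
          have e : g * (a * x ^ n) * g⁻¹ = (g * a * g⁻¹) * (g * x * g⁻¹) ^ n := by
            rw [conj_zpow]; group
          rw [e]
          refine mul_mem (hBA (hAn.conj_mem a ha g)) (zpow_mem ?_ n)
          refine ⟨(x * g * x⁻¹ * g⁻¹)⁻¹, inv_mem (hcomm g), 1, by group⟩
        have hle := hAmax B ⟨hBn, hBab⟩
        have : A = B := Subgroup.eq_of_le_of_card_ge hBA hle
        rw [this]; exact hxB
    obtain ⟨n, hn⟩ := Group.IsNilpotent.nilpotent (G := P)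
    have := key n
    rwa [hn, top_inf_eq] at this
  have hA := hf A hAa
  have hidx := relIndex_centralizer_le (⊤ : Subgroup P) (A : Set P) f
    (by rw [← Nat.card_coe_set_eq]; exact hA) (fun b _ e he => hAn.conj_mem e he b)
  have hA2 : A.index ≤ f ^ f := by
    rw [Subgroup.relIndex_top_right] at hidx
    exact (Nat.le_of_dvd (Nat.pos_of_ne_zero Subgroup.index_ne_zero_of_finite) (Subgroup.index_dvd_of_le hAC)).trans hidx
  rw [← A.card_mul_index]
  exact Nat.mul_le_mul hA hA2

end AbelianBound

/-! ## Part 3: the p-core and Baer's theorem -/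

section Baer

/-- The largest normal `p`-subgroup. -/
def Op (p : ℕ) (G : Type*) [Group G] : Subgroup G := sSup {N : Subgroup G | N.Normal ∧ IsPGroup p N}

theorem le_Op {p : ℕ} {G : Type*} [Group G] {N : Subgroup G} (hN : N.Normal) (h : IsPGroup p N) :
    N ≤ Op p G := le_sSup ⟨hN, h⟩

theorem Op_isPGroup (p : ℕ) (G : Type*) [Group G] : IsPGroup p (Op p G) :=
  Sylow.sSup_of_normal _ (fun _ h => h.2) (fun _ h => h.1)

instance Op_char (p : ℕ) (G : Type*) [Group G] : (Op p G).Characteristic := by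
  rw [Subgroup.characteristic_iff_map_le]
  intro φ
  rw [Subgroup.map_le_iff_le_comap]
  refine sSup_le ?_
  rintro N ⟨hN, hp⟩
  rw [← Subgroup.map_le_iff_le_comap]
  exact le_Op (hN.map _ φ.surjective) (hp.map _)

instance Op_normal (p : ℕ) (G : Type*) [Group G] : (Op p G).Normal := inferInstance

theorem mem_map_conj {G : Type*} [Group G] {S : Subgroup G} {x y : G} :
    y ∈ S.map (MulAut.conj x).toMonoidHom ↔ x⁻¹ * y * x ∈ S := by
  constructor
  · rintro ⟨s, hs, rfl⟩
    simpa [mul_assoc] using hs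
  · intro h
    exact ⟨_, h, by simp [mul_assoc]⟩

/-- `S` lies in a `p`-subgroup of `K` normalized by `K`. -/
def SubP {G : Type*} [Group G] (p : ℕ) (S K : Subgroup G) : Prop :=
  ∃ N : Subgroup G, IsPGroup p N ∧ N ≤ K ∧ K ≤ Subgroup.normalizer (N : Set G) ∧ S ≤ N

theorem SubP.sup {G : Type*} [Group G] {p : ℕ} {S T K : Subgroup G} (h1 : SubP p S K)
    (h2 : SubP p T K) : SubP p (S ⊔ T) K := by
  obtain ⟨N, a1, a2, a3, a4⟩ := h1
  obtain ⟨L, b1, b2, b3, b4⟩ := h2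
  refine ⟨N ⊔ L, a1.to_sup_of_normal_right' b1 (a2.trans b3), sup_le a2 b2, ?_,
    sup_le_sup a4 b4⟩
  intro x hx
  have h1 := Subgroup.mem_normalizer_iff_map_conj_eq.1 (a3 hx)
  have h2 := Subgroup.mem_normalizer_iff_map_conj_eq.1 (b3 hx)
  rw [Subgroup.mem_normalizer_iff_map_conj_eq, Subgroup.map_sup, h1, h2]

theorem SubP.conj {G : Type*} [Group G] {p : ℕ} {S K : Subgroup G} (h : SubP p S K) (x : G) :
    SubP p (S.map (MulAut.conj x).toMonoidHom) (K.map (MulAut.conj x).toMonoidHom) := by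
  obtain ⟨N, a1, a2, a3, a4⟩ := h
  refine ⟨N.map (MulAut.conj x).toMonoidHom, a1.map _, Subgroup.map_mono a2, ?_,
    Subgroup.map_mono a4⟩
  intro y hy
  rw [mem_map_conj] at hy
  have := Subgroup.mem_normalizer_iff.1 (a3 hy)
  rw [Subgroup.mem_normalizer_iff]
  intro n
  rw [mem_map_conj, mem_map_conj, this]
  rw [show x⁻¹ * y * x * (x⁻¹ * n * x) * (x⁻¹ * y * x)⁻¹ = x⁻¹ * (y * n * y⁻¹) * x by group]

theorem zipper {G : Type*} [Group G] [Finite G] (p : ℕ) [Fact p.Prime] :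
    ∀ (n : ℕ) (S : Subgroup G), Nat.card G - Nat.card S = n → IsPGroup p S →
      (∀ K : Subgroup G, S ≤ K → K ≠ ⊤ → SubP p S K) → ¬ SubP p S ⊤ →
      ∀ M K : Subgroup G, IsCoatom M → IsCoatom K → S ≤ M → S ≤ K → M = K := by
  intro n
  induction n using Nat.strong_induction_on with
  | _ n ih =>
  intro S hn hS hsub hno
  have hNtop : Subgroup.normalizer (S : Set G) ≠ ⊤ := by
    intro h
    exact hno ⟨S, hS, le_top, h.ge, le_rfl⟩
  obtain ⟨M, hM, hNM⟩ := (eq_top_or_exists_le_coatom (Subgroup.normalizer (S : Set G))).resolve_left hNtop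
  have hSM : S ≤ M := Subgroup.le_normalizer.trans hNM
  suffices key : ∀ K : Subgroup G, IsCoatom K → S ≤ K → K = M by
    intro A B hA hB hSA hSB
    rw [key A hA hSA, key B hB hSB]
  intro K hK hSK
  by_cases hKN : K ≤ Subgroup.normalizer (S : Set G)
  · by_contra hne
    exact hM.1 (hK.2 M (lt_of_le_of_ne (hKN.trans hNM) hne))
  obtain ⟨x, hxK, hxN, hxS⟩ : ∃ x ∈ K, x ∉ Subgroup.normalizer (S : Set G) ∧
      S.map (MulAut.conj x).toMonoidHom ≤ Subgroup.normalizer (S : Set G) := by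
    obtain ⟨N, hNp, hNK, hKNN, hSN⟩ := hsub K hSK hK.1
    by_cases hNS : N ≤ Subgroup.normalizer (S : Set G)
    · obtain ⟨x, hx, hx2⟩ := SetLike.not_le_iff_exists.1 hKN
      refine ⟨x, hx, hx2, le_trans ?_ hNS⟩
      rintro _ ⟨s, hs, rfl⟩
      exact (Subgroup.mem_normalizer_iff.1 (hKNN hx) s).1 (hSN hs)
    · have : Group.IsNilpotent N := hNp.isNilpotent
      have hlt : (Subgroup.normalizer (S : Set G)).subgroupOf N < ⊤ := by
        rw [lt_top_iff_ne_top, Ne, Subgroup.subgroupOf_eq_top]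
        exact hNS
      have := Group.normalizerCondition_of_isNilpotent (G := N) _ hlt
      obtain ⟨x, hx1, hx2⟩ := SetLike.exists_of_lt this
      refine ⟨x, hNK x.2, hx2, ?_⟩
      rintro _ ⟨s, hs, rfl⟩
      have := (Subgroup.mem_normalizer_iff.1 hx1 ⟨s, hSN hs⟩).1 (Subgroup.le_normalizer hs)
      exact this
  set Sx := S.map (MulAut.conj x).toMonoidHom with hSx
  have hSxK : Sx ≤ K := by
    rintro _ ⟨s, hs, rfl⟩
    exact mul_mem (mul_mem hxK (hSK hs)) (inv_mem hxK)
  have hlt : S < S ⊔ Sx := by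
    refine lt_of_le_of_ne le_sup_left fun h => hxN ?_
    have hle : Sx ≤ S := by rw [h]; exact le_sup_right
    refine Subgroup.mem_normalizer_fintype ?_
    intro s hs
    exact hle ⟨s, hs, rfl⟩
  have hcard : Nat.card S < Nat.card (S ⊔ Sx : Subgroup G) := by
    by_contra hc
    push Not at hc
    exact hlt.ne (Subgroup.eq_of_le_of_card_ge hlt.le hc)
  have hcard2 : Nat.card (S ⊔ Sx : Subgroup G) ≤ Nat.card G := Subgroup.card_le_card_group _
  refine ih (Nat.card G - Nat.card (S ⊔ Sx : Subgroup G)) (by omega) (S ⊔ Sx) rfl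
    (hS.to_sup_of_normal_left' (hS.map _) hxS) ?_ ?_ K M hK hM (sup_le hSK hSxK)
    (sup_le hSM (hxS.trans hNM))
  · intro L hL hLt
    refine SubP.sup (hsub L (le_sup_left.trans hL) hLt) ?_
    have h1 := (hsub (L.map (MulAut.conj x⁻¹).toMonoidHom) ?_ ?_).conj x
    · convert h1
      ext y
      rw [mem_map_conj, mem_map_conj]
      simp [mul_assoc]
    · intro s hs
      rw [mem_map_conj]
      have : x * s * x⁻¹ ∈ L := hL (le_sup_right (a := S) ⟨s, hs, rfl⟩)
      simpa using this
    · intro h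
      apply hLt
      rw [eq_top_iff]
      intro y _
      have : x⁻¹ * y * x ∈ L.map (MulAut.conj x⁻¹).toMonoidHom := by rw [h]; trivial
      rw [mem_map_conj] at this
      simpa [mul_assoc] using this
  · rintro ⟨N, a1, a2, a3, a4⟩
    exact hno ⟨N, a1, a2, a3, le_sup_left.trans a4⟩

theorem baer_aux (p : ℕ) [Fact p.Prime] : ∀ (n : ℕ) (G : Type) (_ : Group G) (_ : Finite G),
    Nat.card G = n → ∀ a : G, IsPGroup p (Subgroup.zpowers a) →
      (∀ x : G, ∃ l, (fun y => engelComm y a)^[l] x = 1) → a ∈ Op p G := by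
  intro n
  induction n using Nat.strong_induction_on with
  | _ n ih =>
  intro G _ _ hn a hap hE
  have hsub : ∀ K : Subgroup G, Subgroup.zpowers a ≤ K → K ≠ ⊤ →
      Subgroup.zpowers a ≤ (Op p K).map K.subtype := by
    intro K haK hKt
    rw [Subgroup.zpowers_le] at haK ⊢
    have hcK : Nat.card K < n := by
      rw [← hn]
      by_contra hc
      push Not at hc
      exact hKt (Subgroup.eq_top_of_le_card K hc)
    refine ⟨⟨a, haK⟩, ih _ hcK K inferInstance inferInstance rfl ⟨a, haK⟩ ?_ ?_, rfl⟩
    · refine hap.of_injective (MonoidHom.codRestrict (K.subtype.comp (Subgroup.zpowers (⟨a, haK⟩ : K)).subtype) (Subgroup.zpowers a) ?_) ?_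
      · rintro ⟨_, k, rfl⟩
        exact ⟨k, by simp⟩
      · intro u v huv
        have := congrArg Subtype.val huv
        exact Subtype.ext (Subtype.ext this)
    · intro x
      obtain ⟨l, hl⟩ := hE x
      refine ⟨l, ?_⟩
      apply K.subtype_injective
      rw [map_engel_iter]
      simpa using hl
  by_contra hcon
  have hno : ¬ SubP p (Subgroup.zpowers a) ⊤ := by
    rintro ⟨N, h1, -, h3, h4⟩
    have hN : N.Normal := Subgroup.normalizer_eq_top_iff.1 (top_le_iff.1 h3)
    exact hcon (le_Op hN h1 (h4 (Subgroup.mem_zpowers a)))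
  have hsub2 : ∀ K : Subgroup G, Subgroup.zpowers a ≤ K → K ≠ ⊤ → SubP p (Subgroup.zpowers a) K := by
    intro K h1 h2
    refine ⟨(Op p K).map K.subtype, (Op_isPGroup p K).map _, ?_, ?_, hsub K h1 h2⟩
    · rintro _ ⟨k, -, rfl⟩; exact k.2
    · intro k hk
      refine Subgroup.mem_normalizer_fintype ?_
      rintro _ ⟨s, hs, rfl⟩
      exact ⟨⟨k, hk⟩ * s * ⟨k, hk⟩⁻¹, (Op_normal p K).conj_mem s hs _, by simp⟩
  have huniq := zipper p _ (Subgroup.zpowers a) rfl hap hsub2 hno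
  have hSt : Subgroup.zpowers a ≠ ⊤ := by
    intro h
    exact hno ⟨⊤, by rw [← h]; exact hap, le_rfl, by rw [Subgroup.normalizer_eq_top], le_top⟩
  obtain ⟨M, hM, hSM⟩ := (eq_top_or_exists_le_coatom (Subgroup.zpowers a)).resolve_left hSt
  have hMN : Subgroup.normalizer (M : Set G) = M := by
    by_contra hne
    have hlt : M < Subgroup.normalizer (M : Set G) :=
      lt_of_le_of_ne Subgroup.le_normalizer (Ne.symm hne)
    have hMn : M.Normal := Subgroup.normalizer_eq_top_iff.1 (hM.2 _ hlt)
    have : ((Op p M).map M.subtype).Normal := inferInstance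
    exact hcon (le_Op this ((Op_isPGroup p M).map _) (hsub M hSM hM.1 (Subgroup.mem_zpowers a)))
  have haM : a ∈ M := hSM (Subgroup.mem_zpowers a)
  obtain ⟨x, -, hx⟩ := SetLike.exists_of_lt (lt_top_iff_ne_top.2 hM.1)
  have hex : ∃ l, (fun y => engelComm y a)^[l] x ∈ M := by
    obtain ⟨l, hl⟩ := hE x
    exact ⟨l, by rw [hl]; exact one_mem _⟩
  classical
  have hj := Nat.find_spec hex
  have hj0 : Nat.find hex ≠ 0 := by
    intro h0
    rw [h0] at hj
    exact hx hj
  obtain ⟨j, hjj⟩ := Nat.exists_eq_succ_of_ne_zero hj0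
  have hy : (fun y => engelComm y a)^[j] x ∉ M := Nat.find_min hex (by omega)
  rw [hjj, Nat.succ_eq_add_one, Function.iterate_succ_apply'] at hj
  set y := (fun y => engelComm y a)^[j] x
  have h1 : y⁻¹ * a * y ∈ M := by
    have h2 : y⁻¹ * a⁻¹ * y * a ∈ M := hj
    have := inv_mem (mul_mem h2 (inv_mem haM))
    simpa [mul_assoc] using this
  have hco : IsCoatom (M.map (MulAut.conj y).toMonoidHom) :=
    ((MulAut.conj y).mapSubgroup.isCoatom_iff M).2 hM
  have hMM : M.map (MulAut.conj y).toMonoidHom = M :=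
    huniq _ _ hco hM (by rw [Subgroup.zpowers_le, mem_map_conj]; exact h1) hSM
  have : y ∈ Subgroup.normalizer (M : Set G) := Subgroup.mem_normalizer_iff_map_conj_eq.2 hMM
  rw [hMN] at this
  exact hy this

theorem baer {G : Type} [Group G] [Finite G] (p : ℕ) [Fact p.Prime] (a : G)
    (ha : IsPGroup p (Subgroup.zpowers a)) (h : ∀ e ∈ sk a, e = 1) : a ∈ Op p G := by
  refine baer_aux p _ G inferInstance inferInstance rfl a ha fun x => ?_
  obtain ⟨l, hl⟩ := exists_iter_mem_sk a x
  exact ⟨l, h _ (hl l le_rfl)⟩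

theorem nilpotent_of_sk_trivial {G : Type} [Group G] [Finite G]
    (h : ∀ a : G, ∀ e ∈ sk a, e = 1) : Group.IsNilpotent G := by
  refine ((Group.isNilpotent_of_finite_tfae (G := G)).out 0 3 :
    Group.IsNilpotent G ↔ ∀ (p : ℕ) (_hp : Fact p.Prime) (P : Sylow p G), (P : Subgroup G).Normal).2 ?_
  intro p hp P
  have : (P : Subgroup G) = Op p G := by
    apply le_antisymm
    · intro a ha
      refine baer p a (P.isPGroup'.to_le (by rw [Subgroup.zpowers_le]; exact ha)) (h a)
    · exact (Op_isPGroup p G).le_sylow_of_normal P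
  rw [this]
  infer_instance

end Baer

/-! ## Part 4: Sylow subgroups modulo the p-core -/

section SylowBound

/-- The bound for abelian subgroups. -/
def fA (m : ℕ) : ℕ := (m ^ m) ^ (m ^ m)

/-- The bound for Sylow subgroups modulo the p-core. -/
def fK (m : ℕ) : ℕ := fA m * fA m ^ fA m

theorem Op_quotient_eq_bot (p : ℕ) (G : Type*) [Group G] : Op p (G ⧸ Op p G) = ⊥ := by
  rw [eq_bot_iff]
  intro q hq
  obtain ⟨g, rfl⟩ := QuotientGroup.mk'_surjective (Op p G) q
  have h1 : (Op p (G ⧸ Op p G)).comap (QuotientGroup.mk' (Op p G)) ≤ Op p G := by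
    refine le_Op inferInstance ((Op_isPGroup p _).comap_of_ker_isPGroup _ ?_)
    rw [QuotientGroup.ker_mk']
    exact Op_isPGroup p G
  have h2 : g ∈ Op p G := h1 hq
  rw [Subgroup.mem_bot]
  exact (QuotientGroup.eq_one_iff g).2 h2

theorem Op_relIndex_eq_card {p : ℕ} {G : Type*} [Group G] (P : Subgroup G) :
    (Op p G).relIndex P = Nat.card (P.map (QuotientGroup.mk' (Op p G))) := by
  rw [← Subgroup.relIndex_ker, QuotientGroup.ker_mk']

theorem Op_relIndex_le {G : Type} [Group G] [Finite G] (m : ℕ) (hm : ∀ g : G, (sk g).ncard ≤ m)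
    (p : ℕ) [Fact p.Prime] (P : Subgroup G) (hP : IsPGroup p P) :
    (Op p G).relIndex P ≤ fK m := by
  rw [Op_relIndex_eq_card]
  set Q := P.map (QuotientGroup.mk' (Op p G)) with hQ
  have hQp : IsPGroup p Q := hP.map _
  have : Group.IsNilpotent Q := hQp.isNilpotent
  refine nilpotent_card_bound (fA m) fun A hA => ?_
  have hc : Nat.card A = Nat.card (A.map Q.subtype) :=
    (Subgroup.card_map_of_injective Q.subtype_injective).symm
  rw [hc]
  refine abelian_bound m ?_ _ ?_ ?_
  · intro g
    obtain ⟨g, rfl⟩ := QuotientGroup.mk'_surjective (Op p G) g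
    exact (sk_map_ncard _ (QuotientGroup.mk'_surjective _) g).trans (hm g)
  · rintro _ ⟨a, ha, rfl⟩ _ ⟨b, hb, rfl⟩
    rw [← map_mul, hA a ha b hb, map_mul]
  · rintro _ ⟨a, ha, rfl⟩ h
    have := baer p (Q.subtype a) (hQp.to_le (by rw [Subgroup.zpowers_le]; exact a.2)) h
    rwa [Op_quotient_eq_bot, Subgroup.mem_bot] at this

theorem le_Op_of_large {G : Type} [Group G] [Finite G] (m : ℕ) (hm : ∀ g : G, (sk g).ncard ≤ m)
    (p : ℕ) [hp : Fact p.Prime] (P : Subgroup G) (hP : IsPGroup p P) (hlt : fK m < p) :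
    P ≤ Op p G := by
  have h := Op_relIndex_le m hm p P hP
  rw [← Subgroup.relIndex_eq_one]
  rw [Op_relIndex_eq_card] at h ⊢
  obtain ⟨k, hk⟩ := IsPGroup.iff_card.1 (hP.map (QuotientGroup.mk' (Op p G)))
  rw [hk] at h ⊢
  rcases Nat.eq_zero_or_pos k with rfl | h0
  · simp
  · have := Nat.le_self_pow h0.ne' p
    omega

theorem index_le_factorial {G : Type*} [Group G] [Finite G] (H : Subgroup G) (K : ℕ)
    (h : ∀ (p : ℕ) (_ : Fact p.Prime), ∃ P : Sylow p G, H.relIndex P ≤ K) :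
    H.index ≤ K.factorial := by
  refine Nat.le_of_dvd (Nat.factorial_pos K) ?_
  rw [Nat.dvd_iff_prime_pow_dvd_dvd]
  intro p k hp hk
  have : Fact p.Prime := ⟨hp⟩
  obtain ⟨P, hP⟩ := h p this
  have h1 : H.relIndex P * (P : Subgroup G).index = (H ⊓ P).index := by
    rw [← Subgroup.inf_relIndex_right, Subgroup.relIndex_mul_index inf_le_right]
  have h2 : p ^ k ∣ H.relIndex P * (P : Subgroup G).index := by
    rw [h1]
    exact hk.trans (Subgroup.index_dvd_of_le inf_le_left)
  have h3 : Nat.Coprime (p ^ k) (P : Subgroup G).index :=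
    Nat.Coprime.pow_left k ((Nat.Prime.coprime_iff_not_dvd hp).2 P.not_dvd_index)
  have h4 := h3.dvd_of_dvd_mul_right h2
  exact Nat.dvd_factorial (pow_pos hp.pos k)
    ((Nat.le_of_dvd (Nat.pos_of_ne_zero (relIndex_ne0 _ _)) h4).trans hP)

end SylowBound

/-! ## Part 5: coprime automorphisms with few periodic commutators -/

section Coprime

theorem periodic_eventually {α : Type*} [Finite α] (f : α → α) (x : α) :
    ∃ l₀ : ℕ, ∀ l ≥ l₀, f^[l] x ∈ Function.periodicPts f := by
  obtain ⟨i, j, hij, h⟩ := Finite.exists_ne_map_eq_of_infinite (fun n : ℕ => f^[n] x)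
  have key : ∀ i j : ℕ, i < j → f^[i] x = f^[j] x →
      ∃ l₀ : ℕ, ∀ l ≥ l₀, f^[l] x ∈ Function.periodicPts f := by
    intro i j hij h
    have h0 : f^[i] x ∈ Function.periodicPts f := by
      refine ⟨j - i, by omega, ?_⟩
      change f^[j - i] _ = _
      rw [← Function.iterate_add_apply, Nat.sub_add_cancel hij.le, h]
    refine ⟨i, fun l hl => ?_⟩
    induction l, hl using Nat.le_induction with
    | base => exact h0
    | succ k _ ih =>
      rw [Function.iterate_succ_apply']
      obtain ⟨n, hn, hx⟩ := ih
      exact ⟨n, hn, hx.apply⟩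
  rcases lt_or_gt_of_ne hij with hl | hl
  · exact key i j hl h
  · exact key j i hl h.symm

theorem periodic_lift {α β : Type*} [Finite α] {f : α → α} {g : β → β} {π : α → β}
    (hπ : Function.Surjective π) (h : Function.Semiconj π f g) {y : β}
    (hy : y ∈ Function.periodicPts g) : ∃ x ∈ Function.periodicPts f, π x = y := by
  obtain ⟨n, hn, hy⟩ := hy
  obtain ⟨x, rfl⟩ := hπ y
  obtain ⟨l, hl⟩ := periodic_eventually f x
  refine ⟨_, hl (n * l) (by nlinarith), ?_⟩
  rw [(h.iterate_right _).eq]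
  exact hy.mul_const l

theorem periodic_map {α β : Type*} {f : α → α} {g : β → β} {π : α → β}
    (h : Function.Semiconj π f g) {x : α}
    (hx : x ∈ Function.periodicPts f) : π x ∈ Function.periodicPts g := by
  obtain ⟨n, hn, hx⟩ := hx
  refine ⟨n, hn, ?_⟩
  change g^[n] (π x) = π x
  rw [← (h.iterate_right _).eq, hx]

/-- The commutator map of an endomorphism. -/
def cm {V : Type*} [Group V] (τ : V →* V) : V → V := fun v => v⁻¹ * τ v

/-- The fixed points of an endomorphism. -/
def Fx {V : Type*} [Group V] (τ : V →* V) : Subgroup V := τ.eqLocus (MonoidHom.id V)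

theorem mem_Fx {V : Type*} [Group V] {τ : V →* V} {v : V} : v ∈ Fx τ ↔ τ v = v := Iff.rfl

theorem coprime_abelian {p r : ℕ} [hp : Fact p.Prime] [hr : Fact r.Prime] (hpr : p ≠ r)
    {Z : Type*} [Group Z] [Finite Z] (hZ : IsPGroup p Z) (hc : ∀ a b : Z, a * b = b * a)
    (τ : Z →* Z) (k : ℕ) (hk : ∀ v, τ^[r ^ k] v = v) :
    (Fx τ).index ≤ (Function.periodicPts (cm τ)).ncard := by
  let Φ : Z →* Z := MonoidHom.mk' (cm τ) (by
    intro a b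
    simp only [cm, map_mul, mul_inv_rev]
    have h1 := hc b⁻¹ a⁻¹
    have h2 := hc b⁻¹ (τ a)
    calc b⁻¹ * a⁻¹ * (τ a * τ b) = a⁻¹ * (b⁻¹ * τ a) * τ b := by rw [h1]; group
      _ = _ := by rw [h2]; group)
  have hΦ : ∀ v, Φ v = v⁻¹ * τ v := fun v => rfl
  have hker : Φ.ker = Fx τ := by
    ext v
    rw [MonoidHom.mem_ker, hΦ, inv_mul_eq_one, mem_Fx, eq_comm]
  have hinj : ∀ x ∈ Φ.range, Φ x = 1 → x = 1 := by
    rintro _ ⟨y, rfl⟩ h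
    have h1 : τ (Φ y) = Φ y := by
      rw [hΦ (Φ y), inv_mul_eq_one] at h; exact h.symm
    have h2 : ∀ n : ℕ, τ^[n] y = y * Φ y ^ n := by
      intro n
      induction n with
      | zero => simp
      | succ n ih =>
        rw [Function.iterate_succ_apply', ih, map_mul, map_pow, h1, pow_succ', ← mul_assoc]
        congr 1
        rw [hΦ]; group
    have h3 := h2 (r ^ k)
    rw [hk] at h3
    have h4 : Φ y ^ r ^ k = 1 := by simpa using h3
    obtain ⟨j, hj⟩ := hZ (Φ y)
    have d1 := orderOf_dvd_of_pow_eq_one h4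
    have d2 := orderOf_dvd_of_pow_eq_one hj
    have hcop : Nat.Coprime (r ^ k) (p ^ j) :=
      Nat.Coprime.pow _ _ ((Nat.coprime_primes hr.out hp.out).2 hpr.symm)
    rw [← orderOf_eq_one_iff]
    exact Nat.eq_one_of_dvd_coprimes hcop d1 d2
  rw [← hker, Subgroup.index_ker, ← Nat.card_coe_set_eq]
  refine Nat.card_mono (Set.toFinite _) ?_
  let ψ : Φ.range → Φ.range := fun x => ⟨Φ x, ⟨x, rfl⟩⟩
  have hψ : Function.Injective ψ := by
    intro a b hab
    have h1 : Φ a = Φ b := congrArg Subtype.val hab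
    have h2 : Φ ((a * b⁻¹ : Φ.range) : Z) = 1 := by
      push_cast
      rw [map_mul, map_inv, h1, mul_inv_cancel]
    have h3 := hinj _ (a * b⁻¹ : Φ.range).2 h2
    have h4 : (a * b⁻¹ : Φ.range) = 1 := Subtype.ext h3
    exact mul_inv_eq_one.1 h4
  intro x hx
  have := Function.Injective.mem_periodicPts hψ ⟨x, hx⟩
  exact periodic_map (π := Subtype.val) (g := cm τ) (fun y => rfl) this

theorem fixed_lift {p r : ℕ} [hp : Fact p.Prime] [hr : Fact r.Prime] (hpr : p ≠ r)
    {V : Type*} [Group V] [Finite V] (hV : IsPGroup p V) (Z : Subgroup V)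
    (τ : V →* V) (hZτ : ∀ z ∈ Z, τ z ∈ Z) (k : ℕ) (hk : ∀ v, τ^[r ^ k] v = v) (v : V)
    (hv : v⁻¹ * τ v ∈ Z) : ∃ z ∈ Z, τ (v * z) = v * z := by
  classical
  have := Fintype.ofFinite V
  let f : Function.End Z := fun z => ⟨v⁻¹ * τ v * τ z, mul_mem hv (hZτ z z.2)⟩
  have hf : ∀ n : ℕ, ∀ z : Z, v * ((f ^ n) z : Z) = τ^[n] (v * z) := by
    intro n
    induction n with
    | zero => intro z; rfl
    | succ n ih =>
      intro z
      rw [pow_succ]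
      have : (f ^ n * f) z = (f ^ n) (f z) := rfl
      rw [this, ih, Function.iterate_succ_apply]
      congr 1
      change v * (v⁻¹ * τ v * τ z) = _
      rw [map_mul]; group
  have hf1 : f ^ r ^ k = 1 := by
    funext z
    have := hf (r ^ k) z
    rw [hk] at this
    exact Subtype.ext (mul_left_cancel this)
  have := Fintype.ofFinite Z
  have hmod := Equiv.Perm.card_fixedPoints_modEq hf1
  by_contra hcon
  push Not at hcon
  have hempty : Fintype.card f.fixedPoints = 0 := by
    rw [Fintype.card_eq_zero_iff]
    refine ⟨fun ⟨z, hz⟩ => hcon z z.2 ?_⟩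
    have h1 : f z = z := hz
    have h2 : v⁻¹ * τ v * τ z = z := congrArg Subtype.val h1
    rw [map_mul]
    nth_rewrite 2 [← h2]
    group
  rw [hempty] at hmod
  have hdvd : r ∣ Fintype.card Z := (Nat.modEq_zero_iff_dvd).1 hmod
  obtain ⟨j, hj⟩ := IsPGroup.iff_card.1 (hV.to_subgroup Z)
  rw [← Nat.card_eq_fintype_card, hj] at hdvd
  have := hr.out.dvd_of_dvd_pow hdvd
  exact hpr ((Nat.prime_dvd_prime_iff_eq hr.out hp.out).1 this).symm

theorem one_mem_periodic_cm {V : Type*} [Group V] (τ : V →* V) :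
    (1 : V) ∈ Function.periodicPts (cm τ) :=
  ⟨1, one_pos, by simp [Function.IsPeriodicPt, Function.IsFixedPt, cm]⟩

theorem coprime_bound {p r : ℕ} [hp : Fact p.Prime] [hr : Fact r.Prime] (hpr : p ≠ r) :
    ∀ (n : ℕ) (V : Type) (_ : Group V) (_ : Finite V), Nat.card V = n → IsPGroup p V →
    ∀ (τ : V →* V) (k : ℕ), (∀ v, τ^[r ^ k] v = v) →
    2 * (Fx τ).index ≤ 2 ^ (Function.periodicPts (cm τ)).ncard := by
  intro n
  induction n using Nat.strong_induction_on with
  | _ n ih =>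
  intro V _ _ hn hV τ k hk
  rcases subsingleton_or_nontrivial V with hs | hnt
  · have h1 : (Fx τ).index = 1 := by
      rw [Subgroup.index_eq_one]; exact Subsingleton.elim _ _
    have h2 : 0 < (Function.periodicPts (cm τ)).ncard :=
      (Set.ncard_pos (Set.toFinite _)).2 ⟨1, one_mem_periodic_cm τ⟩
    rw [h1]
    exact Nat.le_self_pow h2.ne' 2
  set Z := Subgroup.center V with hZ
  have hZτ : ∀ z ∈ Z, τ z ∈ Z := by
    intro z hz
    rw [Subgroup.mem_center_iff] at hz ⊢
    intro g
    obtain ⟨s, hs⟩ : ∃ s, r ^ k = s + 1 := ⟨r ^ k - 1, by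
      have := pow_pos hr.out.pos k; omega⟩
    have hg : τ (τ^[s] g) = g := by
      rw [← Function.iterate_succ_apply' τ s, Nat.succ_eq_add_one, ← hs, hk]
    rw [← hg, ← map_mul, ← map_mul, hz]
  let τZ : Z →* Z := (τ.comp Z.subtype).codRestrict Z fun z => hZτ z z.2
  let τQ : V ⧸ Z →* V ⧸ Z := QuotientGroup.map Z Z τ hZτ
  let π : V →* V ⧸ Z := QuotientGroup.mk' Z
  have hπ : Function.Surjective π := QuotientGroup.mk'_surjective Z
  have sc : Function.Semiconj π τ τQ := fun v => rfl
  have sc2 : Function.Semiconj π (cm τ) (cm τQ) := fun v => rfl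
  have scz : Function.Semiconj (Subtype.val : Z → V) τZ τ := fun v => rfl
  have scz2 : Function.Semiconj (Subtype.val : Z → V) (cm τZ) (cm τ) := fun v => rfl
  have hcard : Nat.card V = Nat.card (V ⧸ Z) * Nat.card Z := Subgroup.card_eq_card_quotient_mul_card_subgroup Z
  have hZ1 : 1 < Nat.card Z := by
    have := hV.bot_lt_center
    rw [Subgroup.one_lt_card_iff_ne_bot]
    exact this.ne'
  have hQlt : Nat.card (V ⧸ Z) < n := by
    rw [← hn, hcard]
    exact lt_mul_of_one_lt_right Nat.card_pos hZ1
  have hQ := ih _ hQlt (V ⧸ Z) inferInstance inferInstance rfl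
    (hV.of_surjective π hπ) τQ k (by
      intro q
      obtain ⟨v, rfl⟩ := hπ q
      rw [← (sc.iterate_right _).eq, hk])
  have hZb := coprime_abelian hpr (hV.to_subgroup Z) (fun a b => Subtype.ext
    ((Subgroup.mem_center_iff.1 b.2) a)) τZ k (by
      intro z
      apply Subtype.ext
      rw [(scz.iterate_right _).eq, hk])
  -- the index inequality
  have hidx : (Fx τ).index ≤ (Fx τQ).index * (Fx τZ).index := by
    have c1 : Nat.card (Fx τQ) * Nat.card (Fx τZ) ≤ Nat.card (Fx τ) := by
      have h1 : Fx τQ ≤ (Fx τ).map π := by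
        intro q hq
        obtain ⟨v, rfl⟩ := hπ q
        rw [mem_Fx, ← sc.eq] at hq
        have hv : v⁻¹ * τ v ∈ Z := QuotientGroup.eq.1 hq.symm
        obtain ⟨z, hz, hvz⟩ := fixed_lift hpr hV Z τ hZτ k hk v hv
        refine ⟨v * z, hvz, ?_⟩
        rw [map_mul, show π z = 1 from (QuotientGroup.eq_one_iff z).2 hz, mul_one]
      have h2 : (Fx τZ).map Z.subtype ≤ Z ⊓ Fx τ := by
        rintro _ ⟨z, hz, rfl⟩
        exact ⟨z.2, congrArg Subtype.val hz⟩
      have h3 : Nat.card ((Fx τ).map π) * Nat.card (Z ⊓ Fx τ : Subgroup V) = Nat.card (Fx τ) := by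
        have e1 : π.ker.relIndex (Fx τ) = _ := Subgroup.relIndex_ker (K := Fx τ) π
        rw [← e1, QuotientGroup.ker_mk', ← Subgroup.inf_relIndex_right, mul_comm,
          ← Subgroup.relIndex_bot_left, ← Subgroup.relIndex_bot_left]
        exact Subgroup.relIndex_mul_relIndex ⊥ (Z ⊓ Fx τ) (Fx τ) bot_le inf_le_right
      have h4 : Nat.card ((Fx τZ).map Z.subtype) = Nat.card (Fx τZ) :=
        Subgroup.card_map_of_injective Z.subtype_injective
      rw [← h3, ← h4]
      exact Nat.mul_le_mul (Subgroup.card_le_of_le h1) (Subgroup.card_le_of_le h2)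
    have e1 := (Fx τ).card_mul_index
    have e2 := (Fx τQ).card_mul_index
    have e3 := (Fx τZ).card_mul_index
    have hpos : 0 < Nat.card (Fx τ) := Nat.card_pos
    refine Nat.le_of_mul_le_mul_left ?_ hpos
    rw [e1, hcard, ← e2, ← e3]
    calc Nat.card (Fx τQ) * (Fx τQ).index * (Nat.card (Fx τZ) * (Fx τZ).index)
        = Nat.card (Fx τQ) * Nat.card (Fx τZ) * ((Fx τQ).index * (Fx τZ).index) := by ring
      _ ≤ _ := Nat.mul_le_mul_right _ c1
  -- the count of periodic points
  have hper : (Function.periodicPts (cm τQ)).ncard + (Function.periodicPts (cm τZ)).ncard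
      ≤ (Function.periodicPts (cm τ)).ncard + 1 := by
    choose! s hs1 hs2 using fun q (hq : q ∈ Function.periodicPts (cm τQ)) =>
      periodic_lift hπ sc2 hq
    have i1 : (s '' (Function.periodicPts (cm τQ) \ {1})).ncard =
        (Function.periodicPts (cm τQ)).ncard - 1 := by
      rw [Set.InjOn.ncard_image, Set.ncard_sdiff_singleton_of_mem (one_mem_periodic_cm τQ)]
      intro a ha b hb hab
      rw [← hs2 a ha.1, ← hs2 b hb.1, hab]
    have i2 : ((Subtype.val : Z → V) '' (Function.periodicPts (cm τZ))).ncard =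
        (Function.periodicPts (cm τZ)).ncard := Set.ncard_image_of_injective _ Subtype.val_injective
    have hdis : Disjoint (s '' (Function.periodicPts (cm τQ) \ {1}))
        ((Subtype.val : Z → V) '' (Function.periodicPts (cm τZ))) := by
      rw [Set.disjoint_left]
      rintro _ ⟨q, hq, rfl⟩ ⟨z, -, hz⟩
      apply hq.2
      rw [Set.mem_singleton_iff, ← hs2 q hq.1, ← hz]
      exact (QuotientGroup.eq_one_iff (z : V)).2 z.2
    have hu := Set.ncard_union_eq hdis (Set.toFinite _) (Set.toFinite _)
    have hle : (s '' (Function.periodicPts (cm τQ) \ {1}) ∪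
        (Subtype.val : Z → V) '' (Function.periodicPts (cm τZ))).ncard ≤
        (Function.periodicPts (cm τ)).ncard := by
      refine Set.ncard_le_ncard ?_ (Set.toFinite _)
      rintro _ (⟨q, hq, rfl⟩ | ⟨z, hz, rfl⟩)
      · exact hs1 q hq.1
      · exact periodic_map scz2 hz
    omega
  have hezpos : 0 < (Function.periodicPts (cm τZ)).ncard :=
    (Set.ncard_pos (Set.toFinite _)).2 ⟨1, one_mem_periodic_cm τZ⟩
  obtain ⟨e, he⟩ : ∃ e, (Function.periodicPts (cm τZ)).ncard = e + 1 :=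
    ⟨_, (Nat.succ_pred_eq_of_pos hezpos).symm⟩
  rw [he] at hper hZb
  have he2 : e + 1 ≤ 2 ^ e := Nat.lt_two_pow_self
  calc 2 * (Fx τ).index ≤ 2 * ((Fx τQ).index * (Fx τZ).index) := Nat.mul_le_mul_left _ hidx
    _ = (2 * (Fx τQ).index) * (Fx τZ).index := by ring
    _ ≤ 2 ^ (Function.periodicPts (cm τQ)).ncard * 2 ^ e := Nat.mul_le_mul hQ (hZb.trans he2)
    _ = 2 ^ ((Function.periodicPts (cm τQ)).ncard + e) := (pow_add _ _ _).symm
    _ ≤ _ := Nat.pow_le_pow_right (by norm_num) (by omega)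

/-- An `r`-element acting on a normal `p`-subgroup centralizes a subgroup of bounded index. -/
theorem relIndex_centralizer_coprime {G : Type} [Group G] [Finite G] (m : ℕ)
    (hm : ∀ g : G, (sk g).ncard ≤ m) {p r : ℕ} [hp : Fact p.Prime] [hr : Fact r.Prime]
    (hpr : p ≠ r) (V : Subgroup G) [hVn : V.Normal] (hV : IsPGroup p V) (t : G)
    (ht : IsPGroup r (Subgroup.zpowers t)) :
    (Subgroup.centralizer {t}).relIndex V ≤ 2 ^ m := by
  have hmem : ∀ v : V, t⁻¹ * (v : G) * t ∈ V := fun v => by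
    simpa using hVn.conj_mem v v.2 t⁻¹
  let τ : V →* V := MonoidHom.mk' (fun v => ⟨t⁻¹ * v * t, hmem v⟩) (by
    intro a b
    apply Subtype.ext
    change t⁻¹ * (a * b : G) * t = t⁻¹ * a * t * (t⁻¹ * b * t)
    group)
  have hτ : ∀ v : V, ((τ v : V) : G) = t⁻¹ * v * t := fun v => rfl
  have hit : ∀ (n : ℕ) (v : V), ((τ^[n] v : V) : G) = (t ^ n)⁻¹ * v * t ^ n := by
    intro n
    induction n with
    | zero => intro v; simp
    | succ n ih =>
      intro v
      rw [Function.iterate_succ_apply', hτ, ih, pow_succ]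
      group
  obtain ⟨k, hk⟩ := ht ⟨t, Subgroup.mem_zpowers t⟩
  have hk' : t ^ r ^ k = 1 := congrArg Subtype.val hk
  have hb := coprime_bound hpr _ V inferInstance inferInstance rfl hV τ k (by
    intro v
    apply Subtype.ext
    rw [hit, hk']; simp)
  have h1 : (Subgroup.centralizer {t}).relIndex V = (Fx τ).index := by
    rw [Subgroup.relIndex]
    congr 1
    ext v
    rw [Subgroup.mem_subgroupOf, Subgroup.mem_centralizer_singleton_iff, mem_Fx, Subtype.ext_iff,
      hτ, mul_assoc, inv_mul_eq_iff_eq_mul]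
  have h2 : (Function.periodicPts (cm τ)).ncard ≤ m := by
    have sc : Function.Semiconj (Subtype.val : V → G) (cm τ) (fun y => engelComm y t) := by
      intro v
      change (v : G)⁻¹ * (t⁻¹ * v * t) = (v : G)⁻¹ * t⁻¹ * v * t
      group
    rw [← Set.ncard_image_of_injective _ (Subtype.val_injective (p := fun x => x ∈ V))]
    refine (Set.ncard_le_ncard ?_ (Set.toFinite _)).trans (hm t)
    rintro _ ⟨v, hv, rfl⟩
    exact periodic_map sc hv
  rw [h1]
  have := Nat.pow_le_pow_right (n := 2) (by norm_num) h2
  omega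

end Coprime

/-! ## Part 6: the centralizer of all sinks has bounded index -/

section CentralizerBound

/-- index bounds -/
def fk (m : ℕ) : ℕ := ((2 ^ m) ^ fK m) ^ (fK m + 1)

/-- index bounds -/
def fB (m : ℕ) : ℕ := (fk m * fK m).factorial

/-- index bounds -/
def fN (m : ℕ) : ℕ := (fk m ^ fB m * fK m).factorial

theorem sk_trivial_of_nilpotent {G : Type*} [Group G] [Group.IsNilpotent G] (g e : G)
    (he : e ∈ sk g) : e = 1 := by
  have step : ∀ i, sk g ⊆ Subgroup.upperCentralSeries G (i + 1) →
      sk g ⊆ Subgroup.upperCentralSeries G i := by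
    intro i h x hx
    obtain ⟨n, hn, hper⟩ := id hx
    obtain ⟨k, rfl⟩ : ∃ k, n = k + 1 := ⟨n - 1, by omega⟩
    have h1 : (fun y => engelComm y g)^[k + 1] x = x := hper
    have hmem : ∀ j : ℕ, (fun y => engelComm y g)^[j] x ∈ sk g := by
      intro j
      induction j with
      | zero => exact hx
      | succ j ih => rw [Function.iterate_succ_apply']; exact engelComm_mem_sk ih
    rw [Function.iterate_succ_apply'] at h1
    rw [← h1]
    have h2 := Subgroup.mem_upperCentralSeries_succ_iff.1 (inv_mem (h (hmem k))) g⁻¹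
    simpa [engelComm, commutatorElement_def] using h2
  obtain ⟨n, hn⟩ := Group.IsNilpotent.nilpotent (G := G)
  have hall : ∀ j, j ≤ n → sk g ⊆ Subgroup.upperCentralSeries G (n - j) := by
    intro j
    induction j with
    | zero => intro _; rw [Nat.sub_zero, hn]; exact fun x _ => trivial
    | succ j ih =>
      intro hj
      apply step
      have : n - (j + 1) + 1 = n - j := by omega
      rw [this]
      exact ih (by omega)
  have h0 := hall n le_rfl he
  rw [Nat.sub_self] at h0
  simpa using h0

/-- A chosen Sylow subgroup. -/
noncomputable def Syl (G : Type*) [Group G] (r : ℕ) : Subgroup G := ((default : Sylow r G) : Subgroup G)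

theorem Syl_isPGroup (G : Type*) [Group G] (r : ℕ) : IsPGroup r (Syl G r) :=
  (default : Sylow r G).isPGroup'

theorem Op_le_Syl (G : Type*) [Group G] (r : ℕ) : Op r G ≤ Syl G r :=
  (Op_isPGroup r G).le_sylow_of_normal _

theorem Op_commute {G : Type*} [Group G] {p r : ℕ} [Fact p.Prime] [Fact r.Prime] (hpr : p ≠ r)
    {x y : G} (hx : x ∈ Op p G) (hy : y ∈ Op r G) : x * y = y * x :=
  Subgroup.commute_of_normal_of_disjoint _ _ (Op_normal p G) (Op_normal r G)
    (IsPGroup.disjoint_of_ne p r hpr _ _ (Op_isPGroup p G) (Op_isPGroup r G)) x y hx hy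

theorem relIndex_le_left {G : Type*} [Group G] [Finite G] {H K : Subgroup G} (L : Subgroup G)
    (h : H ⊓ L ≤ K) : K.relIndex L ≤ H.relIndex L := by
  rw [← Subgroup.inf_relIndex_right H, ← Subgroup.inf_relIndex_right K]
  exact Subgroup.relIndex_le_of_le_left (le_inf h inf_le_right) (relIndex_ne0 _ _)

theorem relIndex_iInf_le_pow {G : Type*} [Group G] [Finite G] {ι : Type*} [Finite ι]
    (f : ι → Subgroup G) (L : Subgroup G) (b k : ℕ) (hb : 0 < b) (h : ∀ i, (f i).relIndex L ≤ b)
    (hk : Nat.card ι ≤ k) : (⨅ i, f i).relIndex L ≤ b ^ k := by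
  have := Fintype.ofFinite ι
  refine (Subgroup.relIndex_iInf_le f).trans ?_
  refine (Finset.prod_le_pow_card _ _ b fun i _ => h i).trans ?_
  rw [Finset.card_univ, ← Nat.card_eq_fintype_card]
  exact Nat.pow_le_pow_right hb hk

theorem centralizer_Syl_relIndex {G : Type} [Group G] [Finite G] (m : ℕ)
    (hm : ∀ g : G, (sk g).ncard ≤ m) {p r : ℕ} [Fact p.Prime] [Fact r.Prime] (hpr : p ≠ r) :
    (Subgroup.centralizer (Syl G r : Set G)).relIndex (Op p G) ≤ (2 ^ m) ^ fK m := by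
  let R := Syl G r
  have hR : IsPGroup r R := Syl_isPGroup G r
  have hcard : Nat.card (R ⧸ (Op r G).subgroupOf R) ≤ fK m := Op_relIndex_le m hm r R hR
  refine le_trans (relIndex_le_left (H := ⨅ q : R ⧸ (Op r G).subgroupOf R,
    Subgroup.centralizer {(q.out : G)}) _ ?_)
    (relIndex_iInf_le_pow _ _ _ _ (by positivity) ?_ hcard)
  · rintro v ⟨hv1, hv2⟩
    rw [Subgroup.mem_centralizer_iff]
    intro t ht
    let t' : R := ⟨t, ht⟩
    let q : R ⧸ (Op r G).subgroupOf R := QuotientGroup.mk t'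
    have h1 : (q.out)⁻¹ * t' ∈ (Op r G).subgroupOf R :=
      QuotientGroup.eq.1 (QuotientGroup.out_eq' q)
    have h2 : (q.out : G)⁻¹ * t ∈ Op r G := h1
    have h3 := Op_commute hpr hv2 h2
    have h4 := (Subgroup.mem_iInf.1 hv1) q
    rw [Subgroup.mem_centralizer_singleton_iff] at h4
    calc t * v = q.out * ((q.out : G)⁻¹ * t * v) := by group
      _ = q.out * v * ((q.out : G)⁻¹ * t) := by rw [← h3]; group
      _ = v * t := by rw [← h4]; group
  · intro q
    exact relIndex_centralizer_coprime m hm hpr (Op p G) (Op_isPGroup p G) _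
      (hR.to_le (by rw [Subgroup.zpowers_le]; exact q.out.2))

theorem exists_D {G : Type} [Group G] [Finite G] (m : ℕ)
    (hm : ∀ g : G, (sk g).ncard ≤ m) (p : ℕ) [hp : Fact p.Prime] : ∃ D : Subgroup G, D ≤ Op p G ∧
    D.relIndex (Op p G) ≤ fk m ∧ ∀ (r : ℕ) (_ : Fact r.Prime), p ≠ r →
      ∀ t ∈ Syl G r, ∀ d ∈ D, t * d = d * t := by
  classical
  let C : Fin (fK m + 1) → Subgroup G := fun i =>
    if Nat.Prime i ∧ p ≠ i then Subgroup.centralizer (Syl G i : Set G) else ⊤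
  refine ⟨Op p G ⊓ ⨅ i, C i, inf_le_left, ?_, ?_⟩
  · rw [Subgroup.inf_relIndex_left]
    refine relIndex_iInf_le_pow C _ _ _ (by positivity) (fun i => ?_) (by simp)
    by_cases hi : Nat.Prime i ∧ p ≠ i
    · have : Fact (Nat.Prime i) := ⟨hi.1⟩
      simp only [C, if_pos hi]
      exact centralizer_Syl_relIndex m hm hi.2
    · simp only [C, if_neg hi, Subgroup.relIndex_top_left]
      exact Nat.one_le_iff_ne_zero.2 (by positivity)
  · rintro r hr hpr t ht d ⟨hd1, hd2⟩
    rcases Nat.lt_or_ge (fK m) r with hlt | hle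
    · have := le_Op_of_large m hm r (Syl G r) (Syl_isPGroup G r) hlt ht
      exact (Op_commute hpr hd1 this).symm
    · have h1 := (Subgroup.mem_iInf.1 hd2) ⟨r, by omega⟩
      have hi : Nat.Prime r ∧ p ≠ r := ⟨hr.out, hpr⟩
      simp only [C, if_pos hi] at h1
      exact Subgroup.mem_centralizer_iff.1 h1 t ht

theorem exists_W {G : Type} [Group G] [Finite G] (m : ℕ)
    (hm : ∀ g : G, (sk g).ncard ≤ m) (p : ℕ) [hp : Fact p.Prime] : ∃ W : Subgroup G, W.Normal ∧ W ≤ Op p G ∧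
    W.relIndex (Op p G) ≤ fk m ^ fB m ∧ ∀ (r : ℕ) (_ : Fact r.Prime), p ≠ r →
      ∀ t ∈ Syl G r, ∀ d ∈ W, t * d = d * t := by
  obtain ⟨D, hDV, hDi, hDc⟩ := exists_D m hm p
  have hfk : 0 < fk m := by unfold fk; positivity
  have hVP := Op_relIndex_le m hm p (Syl G p) (Syl_isPGroup G p)
  have hfK : 0 < fK m := lt_of_lt_of_le (Nat.pos_of_ne_zero (relIndex_ne0 _ _)) hVP
  refine ⟨D.normalCore, inferInstance, (Subgroup.normalCore_le D).trans hDV, ?_,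
    fun r hr hpr t ht d hd => hDc r hr hpr t ht d (Subgroup.normalCore_le D hd)⟩
  have hB : (Subgroup.normalizer (D : Set G)).index ≤ fB m := by
    refine index_le_factorial _ _ fun s hs => ⟨default, ?_⟩
    change (Subgroup.normalizer (D : Set G)).relIndex (Syl G s) ≤ _
    by_cases hps : p = s
    · subst hps
      refine (relIndex_le_left (H := D) _ (inf_le_left.trans Subgroup.le_normalizer)).trans ?_
      rw [← Subgroup.relIndex_mul_relIndex D (Op p G) (Syl G p) hDV (Op_le_Syl G p)]
      exact Nat.mul_le_mul hDi hVP
    · have : (Subgroup.normalizer (D : Set G)).relIndex (Syl G s) = 1 := by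
        rw [Subgroup.relIndex_eq_one]
        intro t ht
        refine Subgroup.mem_normalizer_fintype fun d hd => ?_
        rw [hDc s hs hps t ht d hd, mul_inv_cancel_right]
        exact hd
      rw [this]
      exact Nat.mul_pos hfk hfK
  let F : (G ⧸ Subgroup.normalizer (D : Set G)) → Subgroup G := fun q =>
    D.map (MulAut.conj q.out).toMonoidHom
  have hle : (⨅ q, F q) ≤ D.normalCore := by
    rw [Subgroup.normalCore_eq_iInf_map_conj]
    refine le_iInf fun g => ?_
    let q : G ⧸ Subgroup.normalizer (D : Set G) := QuotientGroup.mk g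
    refine (iInf_le F q).trans ?_
    have h1 : (q.out)⁻¹ * g ∈ Subgroup.normalizer (D : Set G) :=
      QuotientGroup.eq.1 (QuotientGroup.out_eq' q)
    intro x hx
    change x ∈ D.map (MulAut.conj g).toMonoidHom
    change x ∈ D.map (MulAut.conj q.out).toMonoidHom at hx
    rw [mem_map_conj] at hx ⊢
    rw [Subgroup.mem_normalizer_iff.1 h1]
    convert hx using 1
    group
  refine (relIndex_le_left (H := ⨅ q, F q) _ (inf_le_left.trans hle)).trans
    (relIndex_iInf_le_pow F _ _ _ hfk (fun q => ?_) hB)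
  have hV : (Op p G).map (MulAut.conj q.out).toMonoidHom = Op p G :=
    Subgroup.Normal.map_conj_eq (Op p G) q.out
  have := Subgroup.relIndex_map_map_of_injective (f := (MulAut.conj q.out).toMonoidHom) D (Op p G)
    (MulAut.conj q.out).injective
  rw [hV] at this
  change (D.map (MulAut.conj q.out).toMonoidHom).relIndex (Op p G) ≤ _
  rw [this]
  exact hDi

theorem centralizer_sinks_index {G : Type} [Group G] [Finite G] (m : ℕ)
    (hm : ∀ g : G, (sk g).ncard ≤ m) :
    (Subgroup.centralizer {e : G | ∃ g, e ∈ sk g}).index ≤ fN m := by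
  refine index_le_factorial _ _ fun p hp => ⟨default, ?_⟩
  change (Subgroup.centralizer {e : G | ∃ g, e ∈ sk g}).relIndex (Syl G p) ≤ _
  obtain ⟨W, hWn, hWV, hWi, hWc⟩ := exists_W m hm p
  have hVP := Op_relIndex_le m hm p (Syl G p) (Syl_isPGroup G p)
  let C := Subgroup.centralizer (W : Set G)
  have hCn : C.Normal := by
    change (Subgroup.centralizer (W : Set G)).Normal
    infer_instance
  have hC : IsPGroup p (G ⧸ C) := by
    have hidx := Nat.eq_prime_pow_of_unique_prime_dvd (n := C.index) (p := p)
      Subgroup.index_ne_zero_of_finite (by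
        intro r hr hrd
        by_contra hne
        have : Fact r.Prime := ⟨hr⟩
        have hle : Syl G r ≤ C := fun t ht =>
          Subgroup.mem_centralizer_iff.2 fun d hd => (hWc r this (Ne.symm hne) t ht d hd).symm
        exact (default : Sylow r G).not_dvd_index (hrd.trans (Subgroup.index_dvd_of_le hle)))
    exact IsPGroup.of_card hidx
  have : Group.IsNilpotent (G ⧸ C) := hC.isNilpotent
  have hWC : W ≤ Subgroup.centralizer {e : G | ∃ g, e ∈ sk g} := by
    intro w hw
    rw [Subgroup.mem_centralizer_iff]
    rintro e ⟨g, he⟩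
    have h1 := sk_trivial_of_nilpotent _ _ (map_mem_sk (QuotientGroup.mk' C) he)
    have h2 : e ∈ C := (QuotientGroup.eq_one_iff e).1 h1
    exact ((Subgroup.mem_centralizer_iff.1 h2) w hw).symm
  refine (relIndex_le_left (H := W) _ (inf_le_left.trans hWC)).trans ?_
  rw [← Subgroup.relIndex_mul_relIndex W (Op p G) (Syl G p) hWV (Op_le_Syl G p)]
  exact Nat.mul_le_mul hWi hVP

end CentralizerBound

section Final
open scoped commutatorElement

theorem sinks_ncard {G : Type} [Group G] [Finite G] (m n : ℕ)
    (hm : ∀ g : G, (sk g).ncard ≤ m)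
    (hn : (Subgroup.centralizer {e : G | ∃ g, e ∈ sk g}).index ≤ n) :
    {e : G | ∃ g, e ∈ sk g}.ncard ≤ n * m := by
  classical
  set E := {e : G | ∃ g, e ∈ sk g} with hE
  set C := Subgroup.centralizer E with hC
  have := Fintype.ofFinite (G ⧸ C)
  have hsub : E ⊆ ⋃ q : G ⧸ C, sk q.out := by
    rintro e ⟨g, hg⟩
    refine Set.mem_iUnion.2 ⟨(g : G ⧸ C), ?_⟩
    have hz : g⁻¹ * ((g : G ⧸ C).out) ∈ C := by
      rw [← QuotientGroup.eq, QuotientGroup.out_eq']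
    have hz2 : g⁻¹ * ((g : G ⧸ C).out) ∈ Subgroup.centralizer (sk g) :=
      Subgroup.centralizer_le (show sk g ⊆ E from fun x hx => ⟨g, hx⟩) hz
    have := sk_subset_mul_right hz2 hg
    simpa using this
  calc E.ncard ≤ (⋃ q : G ⧸ C, sk q.out).ncard := Set.ncard_le_ncard hsub (Set.toFinite _)
    _ ≤ ∑ q : G ⧸ C, (sk q.out).ncard := Set.ncard_iUnion_le_of_fintype _
    _ ≤ ∑ q : G ⧸ C, m := Finset.sum_le_sum (fun q _ => hm _)
    _ = C.index * m := by
      rw [Finset.sum_const, Finset.card_univ, smul_eq_mul, Subgroup.index, Nat.card_eq_fintype_card]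
    _ ≤ n * m := Nat.mul_le_mul_right _ hn

theorem schur_bound (L : Type*) [Group L] [Finite L] (n : ℕ) (h0 : 0 < n)
    (hn : (Subgroup.center L).index ≤ n) :
    Nat.card (_root_.commutator L) ≤ n ^ (n * (n * n) + 1) := by
  have h1 : Nat.card (commutatorSet L) ≤ n * n := by
    let f : (L ⧸ Subgroup.center L) × (L ⧸ Subgroup.center L) → L := fun q => ⁅q.1.out, q.2.out⁆
    have hsub : commutatorSet L ⊆ Set.range f := by
      rintro _ ⟨a, b, rfl⟩
      refine ⟨((a : L ⧸ Subgroup.center L), (b : L ⧸ Subgroup.center L)), ?_⟩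
      obtain ⟨z, hz⟩ := QuotientGroup.mk_out_eq_mul (Subgroup.center L) a
      obtain ⟨w, hw⟩ := QuotientGroup.mk_out_eq_mul (Subgroup.center L) b
      change ⁅(a : L ⧸ Subgroup.center L).out, (b : L ⧸ Subgroup.center L).out⁆ = _
      rw [hz, hw]
      have hz' := Subgroup.mem_center_iff.1 z.2
      have hw' := Subgroup.mem_center_iff.1 w.2
      generalize (z : L) = z at *
      generalize (w : L) = w at *
      rw [commutatorElement_def, commutatorElement_def]
      calc a * z * (b * w) * (a * z)⁻¹ * (b * w)⁻¹
          = a * (z * (b * w)) * z⁻¹ * a⁻¹ * w⁻¹ * b⁻¹ := by group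
        _ = a * ((b * w) * z) * z⁻¹ * a⁻¹ * w⁻¹ * b⁻¹ := by rw [hz' (b * w)]
        _ = a * b * (w * a⁻¹) * w⁻¹ * b⁻¹ := by group
        _ = a * b * (a⁻¹ * w) * w⁻¹ * b⁻¹ := by rw [hw' a⁻¹]
        _ = a * b * a⁻¹ * b⁻¹ := by group
    calc Nat.card (commutatorSet L) ≤ Nat.card (Set.range f) := Nat.card_mono (Set.toFinite _) hsub
      _ ≤ Nat.card ((L ⧸ Subgroup.center L) × (L ⧸ Subgroup.center L)) :=
        Finite.card_range_le f
      _ = (Subgroup.center L).index * (Subgroup.center L).index := by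
        rw [Nat.card_prod]; rfl
      _ ≤ n * n := Nat.mul_le_mul hn hn
  have h2 := Subgroup.card_commutator_dvd_index_center_pow (G := L)
  have hpos : 0 < (Subgroup.center L).index := Nat.pos_of_ne_zero Subgroup.index_ne_zero_of_finite
  refine (Nat.le_of_dvd (pow_pos hpos _) h2).trans ?_
  refine (Nat.pow_le_pow_left hn _).trans (Nat.pow_le_pow_right h0 ?_)
  exact Nat.succ_le_succ (Nat.mul_le_mul hn h1)

theorem pow_mem_sk {G : Type*} [Group G] (A : Subgroup G) (hA : A.Normal)
    (hab : ∀ a ∈ A, ∀ b ∈ A, a * b = b * a) {x g : G} (hx : x ∈ A) (hs : x ∈ sk g) (j : ℕ) :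
    x ^ j ∈ sk g := by
  have hmem : ∀ y ∈ A, engelComm y g ∈ A := by
    intro y hy
    have h1 := hA.conj_mem y hy g⁻¹
    have := mul_mem (inv_mem hy) h1
    simpa [engelComm, mul_assoc] using this
  have hstep : ∀ y ∈ A, engelComm (y ^ j) g = engelComm y g ^ j := by
    intro y hy
    have h1 := hA.conj_mem y hy g⁻¹
    have hc : Commute y⁻¹ (g⁻¹ * y * g⁻¹⁻¹) := hab _ (inv_mem hy) _ h1
    have h2 := hc.mul_pow j
    rw [conj_pow] at h2
    simp only [engelComm]
    simpa [mul_assoc] using h2.symm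
  have hiter : ∀ k : ℕ, ∀ y ∈ A, (fun y => engelComm y g)^[k] (y ^ j) =
      ((fun y => engelComm y g)^[k] y) ^ j := by
    intro k
    induction k with
    | zero => intro y _; rfl
    | succ k ih =>
      intro y hy
      rw [Function.iterate_succ_apply, Function.iterate_succ_apply, hstep y hy]
      exact ih _ (hmem y hy)
  obtain ⟨k, hk, hx2⟩ := hs
  refine ⟨k, hk, ?_⟩
  change (fun y => engelComm y g)^[k] (x ^ j) = x ^ j
  rw [hiter k x hx]
  have : (fun y => engelComm y g)^[k] x = x := hx2
  rw [this]

theorem pow_factorial_sk {G : Type*} [Group G] [Finite G] (A : Subgroup G) (hA : A.Normal)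
    (hab : ∀ a ∈ A, ∀ b ∈ A, a * b = b * a) {x g : G} (hx : x ∈ A) (hs : x ∈ sk g) (m : ℕ)
    (hm : (sk g).ncard ≤ m) : x ^ m.factorial = 1 := by
  have hsub : (Subgroup.zpowers x : Set G) ⊆ sk g := by
    intro y hy
    have hy2 : y ∈ Submonoid.powers x := mem_powers_iff_mem_zpowers.2 hy
    obtain ⟨j, rfl⟩ := hy2
    exact pow_mem_sk A hA hab hx hs j
  have h1 : orderOf x ≤ m := by
    rw [← Nat.card_zpowers]
    refine le_trans ?_ hm
    rw [← Nat.card_coe_set_eq]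
    exact Nat.card_mono (Set.toFinite _) hsub
  exact orderOf_dvd_iff_pow_eq_one.1 (Nat.dvd_factorial (orderOf_pos x) h1)

theorem comm_bound (A : Type*) [CommGroup A] [Finite A] (S : Set A)
    (hS : Subgroup.closure S = ⊤) (M k : ℕ) (hM : 0 < M) (hs : ∀ s ∈ S, s ^ M = 1)
    (hk : S.ncard ≤ k) : Nat.card A ≤ M ^ k := by
  classical
  have hall : ∀ a : A, a ^ M = 1 := by
    have : Subgroup.closure S ≤ (powMonoidHom M : A →* A).ker := by
      rw [Subgroup.closure_le]
      intro s h
      exact hs s h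
    intro a
    have ha : a ∈ Subgroup.closure S := by rw [hS]; trivial
    exact this ha
  have h1 := card_dvd_exponent_pow_rank' A hall
  refine (Nat.le_of_dvd (pow_pos hM _) h1).trans (Nat.pow_le_pow_right hM ?_)
  have h2 : Group.rank A ≤ (Set.toFinite S).toFinset.card := Group.rank_le (by simpa using hS)
  rw [← Set.ncard_eq_toFinset_card] at h2
  exact h2.trans hk

theorem comm_bound_closure {G : Type*} [Group G] [Finite G] (S : Set G)
    (hab : ∀ a ∈ Subgroup.closure S, ∀ b ∈ Subgroup.closure S, a * b = b * a)
    (M k : ℕ) (hM : 0 < M) (hs : ∀ s ∈ S, s ^ M = 1)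
    (hk : S.ncard ≤ k) : Nat.card (Subgroup.closure S) ≤ M ^ k := by
  letI : CommGroup (Subgroup.closure S) :=
    { (inferInstance : Group (Subgroup.closure S)) with
      mul_comm := fun a b => Subtype.ext (hab a a.2 b b.2) }
  refine comm_bound (Subgroup.closure S) (((↑) : Subgroup.closure S → G) ⁻¹' S)
    Subgroup.closure_closure_coe_preimage M k hM ?_ ?_
  · intro s h
    exact Subtype.ext (hs s h)
  · refine le_trans ?_ hk
    refine Set.ncard_le_ncard_of_injOn _ (fun a ha => ha) (Subtype.val_injective.injOn)
      (Set.toFinite _)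

/-- The final bound. -/
def fF (m : ℕ) : ℕ := fN m ^ (fN m * (fN m * fN m) + 1) * m.factorial ^ (fN m * m)

theorem sinks_closure {G : Type} [Group G] [Finite G] (m : ℕ)
    (hm : ∀ g : G, (sk g).ncard ≤ m) :
    ∃ N : Subgroup G, ∃ _ : N.Normal, Nat.card N ≤ fF m ∧ Group.IsNilpotent (G ⧸ N) := by
  have hn := centralizer_sinks_index m hm
  have hcard := sinks_ncard m (fN m) hm hn
  have h0 : 0 < fN m := Nat.factorial_pos _
  unfold fF
  generalize fN m = n at *
  set E := {e : G | ∃ g, e ∈ sk g} with hE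
  have hconj : ∀ c : G, ∀ e ∈ E, c * e * c⁻¹ ∈ E := by
    rintro c e ⟨g, hg⟩
    exact ⟨_, conj_mem_sk hg⟩
  set L := Subgroup.closure E with hL
  have hLn : L.Normal := by
    refine ⟨fun x hx g => ?_⟩
    have : L ≤ L.comap (MulAut.conj g).toMonoidHom := by
      rw [hL, Subgroup.closure_le]
      intro e he
      exact Subgroup.subset_closure (hconj g e he)
    exact this hx
  refine ⟨L, hLn, ?_, ?_⟩
  · have hcen : (Subgroup.center L).index ≤ n := by
      have h1 : (Subgroup.centralizer E).subgroupOf L ≤ Subgroup.center L := by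
        intro x hx
        rw [Subgroup.mem_subgroupOf, ← Subgroup.centralizer_closure] at hx
        rw [Subgroup.mem_center_iff]
        intro y
        exact Subtype.ext (Subgroup.mem_centralizer_iff.1 hx y y.2)
      have h2 := Subgroup.index_antitone h1
      have h3 : (Subgroup.centralizer E).relIndex L ≤ (Subgroup.centralizer E).index := by
        rw [← Subgroup.relIndex_top_right]
        exact Subgroup.relIndex_le_of_le_right le_top (relIndex_ne0 _ _)
      exact h2.trans (h3.trans hn)
    have hD : Nat.card (⁅L, L⁆ : Subgroup G) ≤ n ^ (n * (n * n) + 1) := by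
      rw [← Subgroup.map_subtype_commutator, Subgroup.card_map_of_injective L.subtype_injective]
      exact schur_bound L n h0 hcen
    let π := QuotientGroup.mk' (⁅L, L⁆ : Subgroup G)
    have hπ : Function.Surjective π := QuotientGroup.mk'_surjective _
    have hAeq : L.map π = Subgroup.closure (π '' E) := MonoidHom.map_closure π E
    have hAn : (L.map π).Normal := hLn.map π hπ
    have hab : ∀ a ∈ L.map π, ∀ b ∈ L.map π, a * b = b * a := by
      rintro _ ⟨a, ha, rfl⟩ _ ⟨b, hb, rfl⟩
      have h1 : π ⁅a, b⁆ = 1 := by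
        rw [← MonoidHom.mem_ker, QuotientGroup.ker_mk']
        exact Subgroup.commutator_mem_commutator ha hb
      rw [map_commutatorElement] at h1
      exact commutatorElement_eq_one_iff_mul_comm.1 h1
    have hA : Nat.card (L.map π) ≤ m.factorial ^ (n * m) := by
      have hs : ∀ s ∈ π '' E, s ^ m.factorial = 1 := by
        rintro _ ⟨e, ⟨g, hg⟩, rfl⟩
        refine pow_factorial_sk (L.map π) hAn hab (x := π e) (g := π g) ?_ (map_mem_sk π hg) m ?_
        · exact ⟨e, Subgroup.subset_closure ⟨g, hg⟩, rfl⟩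
        · exact (sk_map_ncard π hπ g).trans (hm g)
      rw [hAeq] at hab ⊢
      exact comm_bound_closure _ hab _ _ (Nat.factorial_pos _) hs
        ((Set.ncard_image_le (Set.toFinite _)).trans hcard)
    have hprod : Nat.card (⁅L, L⁆ : Subgroup G) * Nat.card (L.map π) = Nat.card L := by
      have e1 : π.ker.relIndex L = _ := Subgroup.relIndex_ker (K := L) π
      rw [← e1, QuotientGroup.ker_mk',
        ← Subgroup.relIndex_bot_left, ← Subgroup.relIndex_bot_left]
      exact Subgroup.relIndex_mul_relIndex ⊥ _ L bot_le (Subgroup.commutator_le_left L L)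
    rw [← hprod]
    exact Nat.mul_le_mul hD hA
  · refine nilpotent_of_sk_trivial ?_
    intro a e he
    obtain ⟨g, rfl⟩ := QuotientGroup.mk'_surjective L a
    obtain ⟨x, hx, rfl⟩ := exists_mem_sk_of_map (QuotientGroup.mk' L)
      (QuotientGroup.mk'_surjective L) he
    rw [← MonoidHom.mem_ker, QuotientGroup.ker_mk']
    exact Subgroup.subset_closure ⟨g, hx⟩

end Final

theorem stmt2 :
    ∃ f : ℕ → ℕ, ∀ (G : Type) (_ : Group G) (_ : Finite G) (m : ℕ), 0 < m →
      (∀ g : G, ∃ E : Set G, IsLeftEngelSink g E ∧ E.ncard ≤ m) →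
      ∃ N : Subgroup G, ∃ _ : N.Normal,
        Nat.card N ≤ f m ∧ Group.IsNilpotent (G ⧸ N) := by
  refine ⟨fF, ?_⟩
  intro G _ _ m _ h
  refine sinks_closure m ?_
  intro g
  obtain ⟨E, hE, hc⟩ := h g
  exact (Set.ncard_le_ncard (sk_subset_sink hE) (Set.toFinite _)).trans hc
end

section
/- Let G be a finite group and m a positive integer. Suppose that every element g ∈ G has a right Engel sink R(g) of cardinality at most m. Then G has a normal subgroup N of order bounded in terms of m (i.e. |N| ≤ f(m) for a function f depending only on m) such that G/N is nilpotent. -/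
/-- `R` is a right Engel sink of `g`: for every `x` all sufficiently long commutators
`[g, x, x, ..., x]` belong to `R`. -/
def IsRightEngelSink {G : Type*} [Group G] (g : G) (R : Set G) : Prop :=
  ∀ x : G, ∃ r₀ : ℕ, ∀ r ≥ r₀, (fun y => engelComm y x)^[r] g ∈ R

namespace EngelSink
open scoped commutatorElement

section Basics
variable {G : Type*} [Group G]

/-- the map `y ↦ [y, x]` -/
def phi (x y : G) : G := y⁻¹ * x⁻¹ * y * x

/-- every element has a right sink with at most `m` elements -/
def Hyp (G : Type*) [Group G] (m : ℕ) : Prop :=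
  ∀ g : G, ∃ R : Set G, IsRightEngelSink g R ∧ R.ncard ≤ m

theorem sink_phi {g : G} {R : Set G} (h : IsRightEngelSink g R) (x : G) :
    ∃ r₀ : ℕ, ∀ r ≥ r₀, (phi x)^[r] g ∈ R := h x

theorem map_phi {H : Type*} [Group H] (f : G →* H) (x y : G) : f (phi x y) = phi (f x) (f y) := by
  simp [phi]

theorem map_phi_iter {H : Type*} [Group H] (f : G →* H) (x y : G) (r : ℕ) :
    f ((phi x)^[r] y) = (phi (f x))^[r] (f y) := by
  induction r with
  | zero => rfl
  | succ n ih => rw [Function.iterate_succ_apply', Function.iterate_succ_apply', map_phi, ih]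

theorem phi_one (x : G) : phi x 1 = 1 := by simp [phi]

theorem phi_iter_one (x : G) (r : ℕ) : (phi x)^[r] 1 = 1 := by
  induction r with
  | zero => rfl
  | succ n ih => rw [Function.iterate_succ_apply', ih, phi_one]

theorem sink_map {H : Type*} [Group H] (f : G →* H) (hf : Function.Surjective f) {g : G}
    {R : Set G} (h : IsRightEngelSink g R) : IsRightEngelSink (f g) (f '' R) := by
  intro x
  obtain ⟨x, rfl⟩ := hf x
  obtain ⟨r, hr⟩ := sink_phi h x
  refine ⟨r, fun k hk => ⟨_, hr k hk, ?_⟩⟩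
  exact map_phi_iter f x g k

theorem Hyp.map {H : Type*} [Group H] [Finite G] {m : ℕ} (h : Hyp G m) (f : G →* H)
    (hf : Function.Surjective f) : Hyp H m := by
  intro g
  obtain ⟨g, rfl⟩ := hf g
  obtain ⟨R, hR, hm⟩ := h g
  exact ⟨f '' R, sink_map f hf hR, (Set.ncard_image_le (Set.toFinite _)).trans hm⟩

theorem Hyp.quot [Finite G] {m : ℕ} (h : Hyp G m) (N : Subgroup G) [N.Normal] : Hyp (G ⧸ N) m :=
  h.map (QuotientGroup.mk' N) (QuotientGroup.mk'_surjective N)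

/-- recurrent values are in the sink -/
theorem sink_of_recurrent {g x y : G} {R : Set G} (h : IsRightEngelSink g R)
    (hy : ∀ n, ∃ r ≥ n, (phi x)^[r] g = y) : y ∈ R := by
  obtain ⟨r, hr⟩ := sink_phi h x
  obtain ⟨k, hk, rfl⟩ := hy r
  exact hr k hk

/-- `z` is periodic for `x` -/
def Per (x z : G) : Prop := z ∈ Function.periodicPts (phi x)

theorem Per.exists {x z : G} (h : Per x z) : ∃ n > 0, (phi x)^[n] z = z := h

theorem Per.iter {x z : G} (h : Per x z) (i : ℕ) : Per x ((phi x)^[i] z) := by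
  obtain ⟨n, hn, h⟩ := h
  exact ⟨n, hn, h.apply_iterate i⟩

theorem Per.recurrent {x z : G} (h : Per x z) (i n : ℕ) :
    ∃ r ≥ n, (phi x)^[r] z = (phi x)^[i] z := by
  obtain ⟨k, hk, h⟩ := h
  refine ⟨i + k * n, by nlinarith, ?_⟩
  rw [Function.iterate_add_apply]
  congr 1
  exact h.mul_const n

theorem exists_per [Finite G] (x g : G) : ∃ r, Per x ((phi x)^[r] g) := by
  obtain ⟨i, j, hij, h⟩ := Finite.exists_ne_map_eq_of_infinite (fun r : ℕ => (phi x)^[r] g)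
  wlog hlt : i < j generalizing i j
  · exact this j i hij.symm h.symm (by omega)
  refine ⟨i, j - i, by omega, ?_⟩
  change (phi x)^[j - i] _ = _
  rw [← Function.iterate_add_apply, Nat.sub_add_cancel hlt.le]
  exact h.symm

theorem Per.map {H : Type*} [Group H] (f : G →* H) {x z : G} (h : Per x z) : Per (f x) (f z) := by
  obtain ⟨n, hn, h⟩ := h
  refine ⟨n, hn, ?_⟩
  change (phi (f x))^[n] (f z) = f z
  rw [← map_phi_iter]; exact congrArg f h

theorem iter_mem_lcs (x y : G) (r : ℕ) : (phi x)^[r] y ∈ (⊤ : Subgroup G).lowerCentralSeries r := by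
  induction r with
  | zero => simp
  | succ n ih =>
    rw [Function.iterate_succ_apply']
    set w := (phi x)^[n] y
    rw [Subgroup.lowerCentralSeries_succ]
    have : phi x w = ⁅w⁻¹, x⁻¹⁆ := by simp [phi, commutatorElement_def]
    rw [this]
    exact Subgroup.commutator_mem_commutator (inv_mem ih) (Subgroup.mem_top _)

theorem Per.eq_one_of_nilpotent [Group.IsNilpotent G] {x z : G} (h : Per x z) : z = 1 := by
  obtain ⟨n, hn⟩ := Subgroup.nilpotent_iff_lowerCentralSeries.1 (inferInstance : Group.IsNilpotent G)
  obtain ⟨r, hr, h⟩ := h.recurrent 0 n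
  have h1 := iter_mem_lcs x z r
  have h2 : (phi x)^[r] z ∈ (⊤ : Subgroup G).lowerCentralSeries n := Subgroup.lowerCentralSeries_antitone _ hr h1
  rw [hn, Subgroup.mem_bot, h] at h2
  exact h2

/-- Heineken's identity -/
theorem heineken (a x : G) (r : ℕ) :
    (phi (a * x * a⁻¹))^[r + 1] x⁻¹ = (a * x) * (phi x)^[r + 2] a * (a * x)⁻¹ := by
  induction r with
  | zero => simp [phi]; group
  | succ n ih =>
    rw [Function.iterate_succ_apply', ih, Function.iterate_succ_apply' _ (n + 2)]
    simp [phi]; group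

theorem per_conj_mem_sink {x z : G} (h : Per x z) {R : Set G} (hR : IsRightEngelSink x⁻¹ R)
    {c : G} (hc : c * x = x * c) (i : ℕ) :
    c * ((z * x) * (phi x)^[i] z * (z * x)⁻¹) * c⁻¹ ∈ R := by
  apply sink_of_recurrent (x := (c * z) * x * (c * z)⁻¹) hR
  intro n
  obtain ⟨r, hr, hi⟩ := h.recurrent i (n + 2)
  obtain ⟨k, rfl⟩ := Nat.exists_eq_add_of_le hr
  have e1 : (phi ((c * z) * x * (c * z)⁻¹))^[n + k + 1] x⁻¹ =
      c * ((phi (z * x * z⁻¹))^[n + k + 1] x⁻¹) * c⁻¹ := by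
    have := map_phi_iter (MulAut.conj c).toMonoidHom (z * x * z⁻¹) x⁻¹ (n + k + 1)
    simp only [MulEquiv.toMonoidHom_eq_coe, MonoidHom.coe_coe, MulAut.conj_apply] at this
    rw [this]
    congr 1
    · rw [mul_inv_rev]; congr 1; group
    · have : c * x⁻¹ = x⁻¹ * c := by
        rw [mul_inv_eq_iff_eq_mul, mul_assoc, hc]; group
      rw [this]; group
  refine ⟨n + k + 1, by omega, ?_⟩
  rw [e1, heineken, ← hi]
  congr 4
  ring_nf
end Basics
end EngelSink

namespace EngelSink
open Subgroup Pointwise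

section OpSec
variable {G : Type*} [Group G] (p : ℕ)

/-- the largest normal `p`-subgroup -/
def Op (G : Type*) [Group G] : Subgroup G := ⨅ P : Sylow p G, (P : Subgroup G)

theorem Op_le (P : Sylow p G) : Op p G ≤ P := iInf_le _ P

theorem Op_isPGroup : IsPGroup p (Op p G) := by
  obtain ⟨P⟩ : Nonempty (Sylow p G) := inferInstance
  exact P.isPGroup'.to_le (Op_le p P)

instance Op_char : (Op p G).Characteristic := by
  rw [Subgroup.characteristic_iff_map_le]
  intro f
  refine le_iInf fun P => ?_
  rw [Subgroup.map_le_iff_le_comap]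
  have hP : IsPGroup p (P.1.map f.symm.toMonoidHom) := P.isPGroup'.map _
  have e : P.1.comap f.toMonoidHom = P.1.map f.symm.toMonoidHom :=
    Subgroup.comap_equiv_eq_map_symm f P.1
  refine (iInf_le _ (Sylow.mk (P.1.comap f.toMonoidHom) (e ▸ hP) ?_))
  intro Q hQ hle
  have h1 := P.is_maximal' (Q := Q.map f.toMonoidHom) (hQ.map _) (by
    intro x hx
    refine ⟨f.symm x, hle ?_, by simp⟩
    simpa using hx)
  rw [← h1]
  ext x; simp [Subgroup.mem_map]

theorem le_Op [Fact p.Prime] [Finite G] {N : Subgroup G} [hN : N.Normal] (h : IsPGroup p N) :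
    N ≤ Op p G := by
  refine le_iInf fun P => ?_
  obtain ⟨Q, hQ⟩ := h.exists_le_sylow
  obtain ⟨g, rfl⟩ := MulAction.exists_smul_eq G Q P
  intro x hx
  have : g⁻¹ * x * g ∈ (Q : Subgroup G) := hQ (by simpa using hN.conj_mem x hx g⁻¹)
  change x ∈ (g • Q : Sylow p G)
  change x ∈ MulAut.conj g • (Q : Subgroup G)
  rw [Subgroup.mem_pointwise_smul_iff_inv_smul_mem]
  simpa [MulAut.smul_def] using this

theorem Op_quot [Fact p.Prime] [Finite G] : Op p (G ⧸ Op p G) = ⊥ := by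
  have h1 : IsPGroup p ((Op p (G ⧸ Op p G)).comap (QuotientGroup.mk' (Op p G))) := by
    apply IsPGroup.comap_of_ker_isPGroup (Op_isPGroup p)
    rw [QuotientGroup.ker_mk']
    exact Op_isPGroup p
  have h2 := le_Op p h1
  rw [eq_bot_iff]
  intro x hx
  obtain ⟨x, rfl⟩ := QuotientGroup.mk'_surjective _ x
  have := h2 (Subgroup.mem_comap.2 hx)
  rw [Subgroup.mem_bot]
  exact (QuotientGroup.eq_one_iff x).2 this

end OpSec

section Baer
variable {G : Type*} [Group G] (p : ℕ)

theorem baer_core_aux [Fact p.Prime] [Finite G] {Ω : Set G}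
    (hconj : ∀ a ∈ Ω, ∀ g, g * a * g⁻¹ ∈ Ω)
    {U1 U2 U3 : Subgroup G} (hU1 : IsCoatom U1) (hU3 : IsCoatom U3)
    (hp : IsPGroup p (closure (Ω ∩ U1)))
    {S : Set G} (hS : S = Ω ∩ (U1 ∩ U2 : Set G))
    (hN : normalizer (closure S : Set G) ≤ U3)
    (hmax : ∀ V, IsCoatom V → V ≠ U1 → S ⊂ Ω ∩ (V ∩ U1 : Set G) → False) : U1 = U3 := by
  have hSc : normalizer S ≤ U3 := (normalizer_le_normalizer_closure S).trans hN
  by_cases hc : Ω ∩ U1 ⊆ U2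
  · have hS' : S = Ω ∩ U1 := by
      rw [hS]; ext x; constructor
      · rintro ⟨h1, h2, h3⟩; exact ⟨h1, h2⟩
      · rintro ⟨h1, h2⟩; exact ⟨h1, h2, hc ⟨h1, h2⟩⟩
    have : U1 ≤ normalizer S := by
      rw [le_set_normalizer_iff, hS']
      rintro h hh g ⟨hg1, hg2⟩
      exact ⟨hconj _ hg1 _, U1.mul_mem (U1.mul_mem hh hg2) (U1.inv_mem hh)⟩
    have h3 := this.trans hSc
    exact ((hU1.le_iff.1 h3).resolve_left hU3.1).symm
  · by_contra hne
    set E1 := closure (Ω ∩ (U1 : Set G)) with hE1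
    have hE1U : E1 ≤ U1 := (closure_le _).2 fun x hx => hx.2
    have hSE : S ⊆ (closure S : Set G) := subset_closure
    have hSU1 : S ⊆ Ω ∩ U1 := by rw [hS]; exact fun x hx => ⟨hx.1, hx.2.1⟩
    have hSU2 : closure S ≤ U2 := by
      rw [closure_le, hS]; exact fun x hx => hx.2.2
    have hfin : {H : Subgroup G | closure S ≤ H ∧ H ≤ E1 ∧ Ω ∩ H ⊆ U2}.Finite := Set.toFinite _
    obtain ⟨H, ⟨hH1, hH2, hH3⟩, hHm⟩ := hfin.exists_maximal
      ⟨closure S, le_rfl, closure_mono hSU1, fun x hx => hSU2 hx.2⟩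
    have hHne : H ≠ E1 := by
      rintro rfl
      exact hc fun x hx => hH3 ⟨hx.1, subset_closure hx⟩
    have hnil : Group.IsNilpotent E1 := IsPGroup.isNilpotent hp
    have hlt : H < normalizer (H : Set G) ⊓ E1 := by
      have h0 := Group.normalizerCondition_of_isNilpotent (G := E1) (H.subgroupOf E1) (by
        rw [lt_top_iff_ne_top, Ne, subgroupOf_eq_top]
        exact fun h => hHne (le_antisymm hH2 h))
      obtain ⟨hle, x, hx, hxn⟩ := SetLike.lt_iff_le_and_exists.1 h0
      refine lt_of_le_of_ne (le_inf le_normalizer hH2) fun heq => hxn ?_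
      rw [← subgroupOf_normalizer_eq hH2] at hx
      rw [mem_subgroupOf] at hx ⊢
      rw [heq]
      exact ⟨hx, x.2⟩
    have : ¬ (Ω ∩ (normalizer (H : Set G) ⊓ E1 : Subgroup G) ⊆ (U2 : Set G)) := by
      intro h
      exact absurd (hHm ⟨hH1.trans hlt.le, inf_le_right, h⟩ hlt.le) (not_le_of_gt hlt)
    obtain ⟨b, ⟨hbΩ, hbN, hbE⟩, hbU⟩ := Set.not_subset.1 this
    have hHS : Ω ∩ H = S := by
      apply Set.Subset.antisymm
      · rw [hS]; exact fun x hx => ⟨hx.1, hE1U (hH2 hx.2), hH3 hx⟩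
      · exact fun x hx => ⟨(hSU1 hx).1, hH1 (subset_closure hx)⟩
    have hbS : b ∈ normalizer S := by
      rw [mem_set_normalizer_iff, ← hHS]
      intro h
      have := (mem_normalizer_iff.1 hbN) h
      constructor
      · rintro ⟨h1, h2⟩; exact ⟨hconj _ h1 _, this.1 h2⟩
      · rintro ⟨h1, h2⟩
        refine ⟨?_, this.2 h2⟩
        have := hconj _ h1 b⁻¹
        simpa [mul_assoc] using this
    refine hmax U3 hU3 (Ne.symm hne) ⟨fun x hx => ⟨(hSU1 hx).1, ?_, (hSU1 hx).2⟩, fun hsub => ?_⟩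
    · exact hN (le_normalizer (subset_closure hx))
    · have : b ∈ S := hsub ⟨hbΩ, hSc hbS, hE1U hbE⟩
      rw [hS] at this
      exact hbU this.2.2

theorem baer_core [Fact p.Prime] [Finite G] {Ω : Set G}
    (hconj : ∀ a ∈ Ω, ∀ g, g * a * g⁻¹ ∈ Ω)
    (hp : ∀ U : Subgroup G, U ≠ ⊤ → IsPGroup p (closure (Ω ∩ U)))
    (hno : ∀ N : Subgroup G, N.Normal → IsPGroup p N → ∀ a ∈ Ω, a ∉ N) :
    ∀ k, ∀ U1 U2 : Subgroup G, IsCoatom U1 → IsCoatom U2 → U1 ≠ U2 →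
      Nat.card G - (Ω ∩ (U1 ∩ U2 : Set G)).ncard = k → Ω ∩ (U1 ∩ U2 : Set G) = ∅ := by
  intro k
  induction k using Nat.strong_induction_on with
  | _ k ih =>
    intro U1 U2 h1 h2 hne hk
    by_contra hS
    rw [← Ne, ← Set.nonempty_iff_ne_empty] at hS
    set S := Ω ∩ (U1 ∩ U2 : Set G) with hSdef
    have hSp : IsPGroup p (closure S) :=
      (hp U1 h1.1).to_le (closure_mono fun x hx => ⟨hx.1, hx.2.1⟩)
    have hNS : normalizer (closure S : Set G) ≠ ⊤ := by
      intro h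
      obtain ⟨a, ha⟩ := hS
      exact hno _ (normalizer_eq_top_iff.1 h) hSp a ha.1 (subset_closure ha)
    obtain ⟨U3, hU3, hle⟩ := (eq_top_or_exists_le_coatom (normalizer (closure S : Set G))).resolve_left hNS
    have key : ∀ V W : Subgroup G, IsCoatom V → IsCoatom W → V ≠ W → S ⊂ Ω ∩ (V ∩ W : Set G) → False := by
      intro V W hV hW hVW hss
      have hc := Set.ncard_lt_ncard hss (Set.toFinite _)
      have hle : (Ω ∩ (V ∩ W : Set G)).ncard ≤ Nat.card G := by
        rw [← Set.ncard_univ]; exact Set.ncard_le_ncard (Set.subset_univ _)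
      have := ih _ (by omega) V W hV hW hVW rfl
      rw [this] at hss
      exact hss.2 (Set.empty_subset _)
    have e1 : U1 = U3 := baer_core_aux p hconj h1 hU3 (hp _ h1.1) hSdef hle
      fun V hV hn => key V U1 hV h1 hn
    have e2 : U2 = U3 := baer_core_aux p hconj (U2 := U1) h2 hU3 (hp _ h2.1)
      (by rw [hSdef, Set.inter_comm (U1 : Set G)]) hle
      fun V hV hn => key V U2 hV h2 hn
    exact hne (e1.trans e2.symm)

theorem baer_aux [Fact p.Prime] : ∀ n, ∀ (G : Type*) [Group G] [Finite G], Nat.card G = n → ∀ a : G,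
    (∃ k, a ^ p ^ k = 1) → (∀ g, ∃ r, (phi a)^[r] g = 1) → a ∈ Op p G := by
  intro n
  induction n using Nat.strong_induction_on with
  | _ n ih =>
  intro G _ _ hn a hap haE
  by_contra haO
  set Ω : Set G := {b | ∃ g, b = g * a * g⁻¹} with hΩ
  have haΩ : a ∈ Ω := ⟨1, by simp⟩
  have hconj : ∀ a ∈ Ω, ∀ g, g * a * g⁻¹ ∈ Ω := by
    rintro _ ⟨h, rfl⟩ g; exact ⟨g * h, by group⟩
  have hΩp : ∀ b ∈ Ω, (∃ k, b ^ p ^ k = 1) := by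
    rintro _ ⟨h, rfl⟩
    obtain ⟨k, hk⟩ := hap
    exact ⟨k, by rw [conj_pow, hk]; group⟩
  have hΩE : ∀ b ∈ Ω, ∀ g, ∃ r, (phi b)^[r] g = 1 := by
    rintro _ ⟨h, rfl⟩ g
    obtain ⟨r, hr⟩ := haE (h⁻¹ * g * h)
    refine ⟨r, ?_⟩
    have := map_phi_iter (MulAut.conj h).toMonoidHom a (h⁻¹ * g * h) r
    rw [hr] at this
    simpa [mul_assoc] using this.symm
  have hno : ∀ N : Subgroup G, N.Normal → IsPGroup p N → ∀ a ∈ Ω, a ∉ N := by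
    rintro N hN hNp _ ⟨g, rfl⟩ h
    apply haO
    apply le_Op p hNp
    have := hN.conj_mem _ h g⁻¹
    simpa [mul_assoc] using this
  have hOpU : ∀ U : Subgroup G, U ≠ ⊤ → Ω ∩ U ⊆ ((Op p U).map U.subtype : Subgroup G) := by
    rintro U hU b ⟨hb, hbU⟩
    have hlt : Nat.card U < n := by
      rw [← hn]
      refine lt_of_le_of_ne (Nat.card_le_card_of_injective _ U.subtype_injective) fun h => hU ?_
      exact Subgroup.eq_top_of_card_eq U h
    refine ⟨⟨b, hbU⟩, ih _ hlt U rfl ⟨b, hbU⟩ ?_ ?_, rfl⟩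
    · obtain ⟨k, hk⟩ := hΩp b hb
      exact ⟨k, by ext; simpa using hk⟩
    · intro g
      obtain ⟨r, hr⟩ := hΩE b hb g
      refine ⟨r, ?_⟩
      apply U.subtype_injective
      rw [map_phi_iter]
      simpa using hr
  have hp : ∀ U : Subgroup G, U ≠ ⊤ → IsPGroup p (closure (Ω ∩ U)) := by
    intro U hU
    exact ((Op_isPGroup p (G := U)).map _).to_le ((closure_le _).2 (hOpU U hU))
  have huniq : ∀ U1 U2 : Subgroup G, IsCoatom U1 → IsCoatom U2 → ∀ b ∈ Ω, b ∈ U1 → b ∈ U2 → U1 = U2 := by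
    intro U1 U2 h1 h2 b hb hb1 hb2
    by_contra hne
    have := baer_core p hconj hp hno _ U1 U2 h1 h2 hne rfl
    rw [Set.eq_empty_iff_forall_notMem] at this
    exact this b ⟨hb, hb1, hb2⟩
  have hz : zpowers a ≠ ⊤ := by
    intro h
    have hzp : IsPGroup p (zpowers a) := by
      rintro ⟨x, hx⟩
      obtain ⟨j, rfl⟩ := mem_zpowers_iff.1 hx
      obtain ⟨k, hk⟩ := hap
      refine ⟨k, ?_⟩
      ext
      simp only [SubmonoidClass.mk_pow, OneMemClass.coe_one]
      rw [← zpow_natCast, ← zpow_mul, mul_comm, zpow_mul, zpow_natCast, hk, one_zpow]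
    exact hno _ (h ▸ inferInstance) hzp a haΩ (mem_zpowers a)
  obtain ⟨U, hU, hle⟩ := (eq_top_or_exists_le_coatom (zpowers a)).resolve_left hz
  have haU : a ∈ U := hle (mem_zpowers a)
  have hUn : ¬ U.Normal := by
    intro hn
    exact hno _ (inferInstanceAs ((Op p U).map U.subtype).Normal)
      ((Op_isPGroup p (G := U)).map _) a haΩ (hOpU U hU.1 ⟨haΩ, haU⟩)
  have hNU : normalizer (U : Set G) = U := by
    refine (hU.le_iff.1 le_normalizer).resolve_left fun h => hUn (normalizer_eq_top_iff.1 h)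
  have key : ∀ g, g ∉ U → phi a g ∉ U := by
    intro g hg hphi
    apply hg
    have h1 : g⁻¹ * a⁻¹ * g ∈ U := by
      have := U.mul_mem hphi (U.inv_mem haU)
      simpa [phi] using this
    have h2 : g⁻¹ * a * g ∈ U := by
      have := U.inv_mem h1
      simpa [mul_assoc] using this
    have hUg : U.map (MulAut.conj g).toMonoidHom = U := by
      refine huniq _ _ ?_ hU a haΩ ?_ haU
      · exact (OrderIso.isCoatom_iff (MulAut.conj g).mapSubgroup U).2 hU
      · exact ⟨_, h2, by simp [mul_assoc]⟩
    rw [← hNU]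
    exact mem_normalizer_iff_map_conj_eq.2 hUg
  obtain ⟨g, hg⟩ : ∃ g, g ∉ U := by
    by_contra! h
    exact hU.1 (eq_top_iff.2 fun x _ => h x)
  obtain ⟨r, hr⟩ := haE g
  have : ∀ r, (phi a)^[r] g ∉ U := by
    intro r
    induction r with
    | zero => exact hg
    | succ n ih => rw [Function.iterate_succ_apply']; exact key _ ih
  exact this r (hr ▸ U.one_mem)

theorem baer [Fact p.Prime] [Finite G] {a : G} (ha : ∃ k, a ^ p ^ k = 1) (hO : a ∉ Op p G) :
    ∃ z, Per a z ∧ z ≠ 1 := by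
  by_contra! h
  apply hO
  refine baer_aux p _ G rfl a ha fun g => ?_
  obtain ⟨r, hr⟩ := exists_per a g
  exact ⟨r, h _ hr⟩

end Baer
end EngelSink

namespace EngelSink
open Subgroup
open scoped commutatorElement

section cent_index
variable {G : Type*} [Group G]

theorem relIndex_le_of_fun (H B : Subgroup G) {X : Type*} [Finite X] (f : B → X)
    (h : ∀ b b' : B, f b = f b' → (b : G)⁻¹ * b' ∈ H) : H.relIndex B ≤ Nat.card X := by
  rw [relIndex, index_eq_card]
  refine Nat.card_le_card_of_injective (fun c : B ⧸ H.subgroupOf B => f c.out) ?_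
  intro c d hcd
  have := h _ _ hcd
  rw [← c.out_eq', ← d.out_eq']
  exact QuotientGroup.eq.2 (by simpa [mem_subgroupOf] using this)

theorem card_inf_mul_relIndex (H B : Subgroup G) :
    Nat.card (H ⊓ B : Subgroup G) * H.relIndex B = Nat.card B := by
  rw [← inf_relIndex_right, ← relIndex_bot_left, ← relIndex_bot_left]
  exact relIndex_mul_relIndex _ _ _ bot_le inf_le_right

theorem cent_index [Finite G] (B : Subgroup G) (S R : Set G)
    (h : ∀ b ∈ B, ∀ s ∈ S, b * s * b⁻¹ ∈ R) :
    (centralizer S).relIndex B ≤ R.ncard ^ S.ncard := by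
  have := relIndex_le_of_fun (centralizer S) B (X := S → R)
    (fun b s => ⟨b * s * (b : G)⁻¹, h b b.2 s s.2⟩) (by
      intro b b' hb
      rw [mem_centralizer_iff]
      intro s hs
      have := congrArg Subtype.val (congrFun hb ⟨s, hs⟩)
      simp only at this
      have h2 : (b : G) * s * (b : G)⁻¹ * b' = b' * s := by rw [this]; group
      have : s * ((b : G)⁻¹ * b') = (b : G)⁻¹ * (b * s * (b : G)⁻¹ * b') := by group
      rw [this, h2]; group)
  rwa [Nat.card_fun, Nat.card_coe_set_eq, Nat.card_coe_set_eq] at this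

theorem pow_le_self_pow {a b m : ℕ} (hm : 0 < m) (ha : a ≤ m) (hb : b ≤ m) : a ^ b ≤ m ^ m :=
  (Nat.pow_le_pow_left ha b).trans (Nat.pow_le_pow_right hm hb)

theorem mem_normalizer_of_inv [Finite G] {Z : Subgroup G} {x : G} (h : ∀ u ∈ Z, x⁻¹ * u * x ∈ Z) :
    x ∈ normalizer (Z : Set G) := by
  rw [← inv_mem_iff]
  exact mem_normalizer_fintype (fun n hn => by simpa using h n hn)

/-- the data attached to an element with a nontrivial periodic point -/
theorem K2 [Finite G] {m : ℕ} (hm : 0 < m) (hyp : Hyp G m) {x z : G} (hz : Per x z) (hz1 : z ≠ 1) :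
    ∃ (Z : Subgroup G) (y : G), (∀ u ∈ Z, x⁻¹ * u * x ∈ Z) ∧ y ∈ Z ∧ y * x ≠ x * y ∧
      (∀ B : Subgroup G, (∀ b ∈ B, b * x = x * b) → (centralizer (Z : Set G)).relIndex B ≤ m ^ m) ∧
      (∀ w, (∀ u ∈ Z, w⁻¹ * u * w = x⁻¹ * u * x) → ∀ R, IsRightEngelSink w⁻¹ R → y ∈ R) := by
  set zi : ℕ → G := fun i => (phi x)^[i] z with hzi
  set Z := closure (Set.range zi) with hZ
  have hziZ : ∀ i, zi i ∈ Z := fun i => subset_closure ⟨i, rfl⟩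
  have hzZ : z ∈ Z := hziZ 0
  have hinv : ∀ u ∈ Z, x⁻¹ * u * x ∈ Z := by
    have : Z ≤ Z.comap (MulAut.conj x⁻¹).toMonoidHom := by
      rw [hZ, closure_le]
      rintro _ ⟨i, rfl⟩
      have e : x⁻¹ * zi i * x = zi i * zi (i + 1) := by
        have : zi (i + 1) = phi x (zi i) := Function.iterate_succ_apply' _ _ _
        rw [this, phi]; group
      have := Z.mul_mem (hziZ i) (hziZ (i + 1))
      rw [← e] at this
      simpa using this
    intro u hu
    simpa using this hu
  have hxN := mem_normalizer_of_inv hinv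
  have hzxN : z * x ∈ normalizer (Z : Set G) := mul_mem (le_normalizer hzZ) hxN
  set S : Set G := Set.range fun i => (z * x) * zi i * (z * x)⁻¹ with hS
  have hSZ : closure S = Z := by
    have h1 : closure S = Z.map (MulAut.conj (z * x)).toMonoidHom := by
      rw [hZ, MonoidHom.map_closure, ← Set.range_comp]; rfl
    rw [h1]
    exact mem_normalizer_iff_map_conj_eq.1 hzxN
  have hcent : centralizer (S : Set G) = centralizer (Z : Set G) := by
    rw [← hSZ, centralizer_closure]
  obtain ⟨y, hyS, hyx⟩ : ∃ y ∈ S, y * x ≠ x * y := by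
    by_contra! hcon
    have hxc : x ∈ centralizer (S : Set G) := mem_centralizer_iff.2 hcon
    rw [hcent, mem_centralizer_iff] at hxc
    have h1 : phi x z = 1 := by
      have := hxc z hzZ
      rw [phi, mul_assoc, this]; group
    obtain ⟨n, hn, h⟩ := hz.exists
    obtain ⟨k, rfl⟩ := Nat.exists_eq_succ_of_ne_zero hn.ne'
    rw [Function.iterate_succ_apply, h1, phi_iter_one] at h
    exact hz1 h.symm
  refine ⟨Z, y, hinv, hSZ ▸ subset_closure hyS, hyx, ?_, ?_⟩
  · intro B hB
    obtain ⟨R, hR, hRm⟩ := hyp x⁻¹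
    rw [← hcent]
    have hmem : ∀ b, b * x = x * b → ∀ s ∈ S, b * s * b⁻¹ ∈ R := by
      rintro b hb _ ⟨i, rfl⟩
      exact per_conj_mem_sink hz hR hb i
    have hSR : S ⊆ R := fun s hs => by simpa using hmem 1 (by simp) s hs
    exact (cent_index B S R fun b hb s hs => hmem b (hB b hb) s hs).trans
      (pow_le_self_pow hm hRm ((Set.ncard_le_ncard hSR).trans hRm))
  · intro w hw R hR
    have hiter : ∀ i, (phi w)^[i] z = zi i := by
      intro i
      induction i with
      | zero => rfl
      | succ n ih =>
        rw [Function.iterate_succ_apply', ih]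
        simp only [hzi]
        rw [Function.iterate_succ_apply']
        have := hw _ (hziZ n)
        simp only [hzi] at this
        simp only [phi, mul_assoc] at this ⊢
        rw [this]
    have hper : Per w z := by
      obtain ⟨n, hn, h⟩ := hz.exists
      exact ⟨n, hn, (hiter n).trans h⟩
    obtain ⟨i, rfl⟩ := hyS
    have := per_conj_mem_sink hper hR (c := 1) (by simp) i
    rw [hiter] at this
    have h2 : w * zi i * w⁻¹ = x * zi i * x⁻¹ := by
      have := hw _ ((mem_normalizer_iff.1 hxN _).1 (hziZ i))
      have h3 : x⁻¹ * (x * zi i * x⁻¹) * x = zi i := by group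
      rw [h3] at this
      calc w * zi i * w⁻¹ = w * (w⁻¹ * (x * zi i * x⁻¹) * w) * w⁻¹ := by rw [this]
        _ = _ := by group
    have e : z * x * zi i * (z * x)⁻¹ = 1 * (z * w * zi i * (z * w)⁻¹) * 1⁻¹ := by
      calc _ = z * (x * zi i * x⁻¹) * z⁻¹ := by group
        _ = z * (w * zi i * w⁻¹) * z⁻¹ := by rw [h2]
        _ = _ := by group
    simp only
    rw [e]; exact this
end cent_index

section Comb
variable {G : Type*} [Group G] [Finite G]

theorem greedy {q : ℕ} (hq : 0 < q) (A : Subgroup G) (Z : G → Subgroup G) (y : G → G)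
    (hy : ∀ a ∈ A, a ≠ 1 → y a ∈ Z a) (hya : ∀ a ∈ A, a ≠ 1 → y a * a ≠ a * y a)
    (hidx : ∀ a ∈ A, a ≠ 1 → ∀ B ≤ A, (centralizer (Z a : Set G)).relIndex B ≤ q)
    (c : ℕ) (hc : 1 ≤ c) : ∀ k, ∀ B ≤ A, q ^ k * c < Nat.card B →
      ∃ Γ : Finset G, Γ.card = k ∧ (∀ α ∈ Γ, α ∈ B ∧ α ≠ 1) ∧
        (∀ α ∈ Γ, ∀ β ∈ Γ, α ≠ β → β ∈ centralizer (Z α : Set G) ∨ α ∈ centralizer (Z β : Set G)) ∧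
        ∃ B' ≤ B, c < Nat.card B' ∧ ∀ α ∈ Γ, B' ≤ centralizer (Z α : Set G) := by
  classical
  intro k
  induction k with
  | zero =>
    intro B hB hc
    exact ⟨∅, rfl, by simp, by simp, B, le_rfl, by simpa using hc, by simp⟩
  | succ k ih =>
    intro B hB hcB
    have h1 : 1 < Nat.card B :=
      lt_of_le_of_lt (Nat.succ_le_of_lt (Nat.mul_pos (Nat.pow_pos hq) hc)) hcB
    have := Finite.one_lt_card_iff_nontrivial.1 h1
    obtain ⟨⟨α, hαB⟩, hα⟩ := exists_ne (1 : B)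
    have hα1 : α ≠ 1 := fun h => hα (Subtype.ext h)
    have hi := hidx α (hB hαB) hα1 B hB
    have hcard := card_inf_mul_relIndex (centralizer (Z α : Set G)) B
    obtain ⟨Γ, hΓc, hΓ1, hΓ2, B', hB', hB'c, hB'2⟩ := ih (centralizer (Z α : Set G) ⊓ B)
      (inf_le_right.trans hB) (by
        rw [← hcard, pow_succ] at hcB
        by_contra hcon
        push Not at hcon
        have : Nat.card (centralizer (Z α : Set G) ⊓ B : Subgroup G) *
          (centralizer (Z α : Set G)).relIndex B ≤ q ^ k * c * q := Nat.mul_le_mul hcon hi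
        have e : q ^ k * q * c = q ^ k * c * q := by ring
        omega)
    have hαΓ : α ∉ Γ := fun h => hya α (hB hαB) hα1
      (mem_centralizer_iff.1 (hΓ1 α h).1.1 _ (hy α (hB hαB) hα1))
    refine ⟨insert α Γ, by rw [Finset.card_insert_of_notMem hαΓ, hΓc], ?_, ?_, B',
      hB'.trans inf_le_right, hB'c, ?_⟩
    · intro β hβ
      rcases Finset.mem_insert.1 hβ with rfl | hβ
      · exact ⟨hαB, hα1⟩
      · exact ⟨(hΓ1 β hβ).1.2, (hΓ1 β hβ).2⟩
    · intro β hβ γ hγ hne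
      rcases Finset.mem_insert.1 hβ with h1 | h1 <;> rcases Finset.mem_insert.1 hγ with h2 | h2
      · exact absurd (h1.trans h2.symm) hne
      · exact Or.inl (h1 ▸ (hΓ1 γ h2).1.1)
      · exact Or.inr (h2 ▸ (hΓ1 β h1).1.1)
      · exact hΓ2 β h1 γ h2 hne
    · intro β hβ
      rcases Finset.mem_insert.1 hβ with rfl | hβ
      · exact hB'.trans inf_le_left
      · exact hB'2 β hβ

/-- the bound in the combinatorial lemma -/
def comb (q : ℕ) : ℕ → ℕ
  | 0 => 1
  | s + 1 => q ^ (q ^ s + 1) * comb q s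

theorem comb_pos {q : ℕ} (hq : 0 < q) (s : ℕ) : 1 ≤ comb q s := by
  induction s with
  | zero => exact le_rfl
  | succ n ih => exact Nat.mul_pos (Nat.pow_pos hq) ih

theorem comb_lemma {q : ℕ} (hq : 0 < q) (A : Subgroup G) (Z : G → Subgroup G) (y : G → G)
    (hZ : ∀ a ∈ A, a ≠ 1 → ∀ u ∈ Z a, a⁻¹ * u * a ∈ Z a)
    (hy : ∀ a ∈ A, a ≠ 1 → y a ∈ Z a) (hya : ∀ a ∈ A, a ≠ 1 → y a * a ≠ a * y a)
    (hidx : ∀ a ∈ A, a ≠ 1 → ∀ B ≤ A, (centralizer (Z a : Set G)).relIndex B ≤ q) :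
    ∀ s, ∀ B ≤ A, comb q s < Nat.card B →
      ∃ w ∈ B, ∃ T' : Finset G, T'.card = s ∧ (∀ a ∈ T', a ∈ B ∧ a ≠ 1) ∧
        (∀ a ∈ T', ∀ u ∈ Z a, w⁻¹ * u * w = a⁻¹ * u * a) ∧ Set.InjOn y T' := by
  classical
  intro s
  induction s with
  | zero => intro B hB _; exact ⟨1, B.one_mem, ∅, rfl, by simp, by simp, by simp⟩
  | succ s ih =>
    intro B hB hcB
    obtain ⟨Γ, hΓc, hΓ1, hΓ2, B', hB', hB'c, hB'2⟩ :=
      greedy hq A Z y hy hya hidx (comb q s) (comb_pos hq s) (q ^ s + 1) B hB hcB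
    obtain ⟨w', hw', S, hSc, hS1, hS2, hS3⟩ := ih B' (hB'.trans hB) hB'c
    set C : Subgroup G := ⨅ a : S, centralizer (Z a : Set G) with hC
    have hCidx : C.relIndex B ≤ q ^ s := by
      refine (relIndex_iInf_le _).trans ?_
      refine (Finset.prod_le_pow_card _ _ q ?_).trans ?_
      · rintro ⟨a, ha⟩ -
        exact hidx a (hB (hB' (hS1 a ha).1)) (hS1 a ha).2 B hB
      · rw [Finset.card_univ, Fintype.card_coe, hSc]
    obtain ⟨α, hα, β, hβ, hne, hCαβ⟩ : ∃ α ∈ Γ, ∃ β ∈ Γ, α ≠ β ∧ β⁻¹ * α ∈ C := by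
      by_contra! hcon
      have hinj : Function.Injective (fun g : Γ =>
          (QuotientGroup.mk (⟨g, (hΓ1 g g.2).1⟩ : B) : B ⧸ C.subgroupOf B)) := by
        intro g h hgh
        by_contra hne
        have := QuotientGroup.eq.1 hgh
        exact hcon h h.2 g g.2 (fun e => hne (Subtype.ext e.symm)) (by simpa [mem_subgroupOf] using this)
      have := Nat.card_le_card_of_injective _ hinj
      rw [← index_eq_card, Nat.card_eq_fintype_card, Fintype.card_coe, hΓc] at this
      exact absurd (this.trans hCidx) (by omega)
    have key : ∀ α ∈ Γ, ∀ β ∈ Γ, β⁻¹ * α ∈ C → β ∈ centralizer (Z α : Set G) →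
        ∃ w ∈ B, ∃ T' : Finset G, T'.card = s + 1 ∧ (∀ a ∈ T', a ∈ B ∧ a ≠ 1) ∧
        (∀ a ∈ T', ∀ u ∈ Z a, w⁻¹ * u * w = a⁻¹ * u * a) ∧ Set.InjOn y T' := by
      intro α hα β hβ hbC hβα
      obtain ⟨hαB, hα1⟩ := hΓ1 α hα
      obtain ⟨hβB, hβ1⟩ := hΓ1 β hβ
      set b := β⁻¹ * α with hb
      have hbα : ∀ u ∈ Z α, b⁻¹ * u * b = α⁻¹ * u * α := by
        intro u hu
        have := mem_centralizer_iff.1 hβα u hu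
        calc b⁻¹ * u * b = α⁻¹ * (β * u) * β⁻¹ * α := by rw [hb]; group
          _ = α⁻¹ * (u * β) * β⁻¹ * α := by rw [this]
          _ = _ := by group
      have hbS : ∀ a ∈ S, ∀ u ∈ Z a, b⁻¹ * u * b = u := by
        intro a ha u hu
        have h1 : b ∈ centralizer (Z a : Set G) := (mem_iInf.1 hbC) ⟨a, ha⟩
        have := mem_centralizer_iff.1 h1 u hu
        rw [mul_assoc, this]; group
      have hαS : α ∉ S := fun h => hya α (hB hαB) hα1
        (mem_centralizer_iff.1 (hB'2 α hα (hS1 α h).1) _ (hy α (hB hαB) hα1))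
      have hyne : ∀ a ∈ S, y a ≠ y α := by
        intro a ha heq
        have h1 := hbS a ha (y a) (hy a (hB (hB' (hS1 a ha).1)) (hS1 a ha).2)
        rw [heq, hbα _ (hy α (hB hαB) hα1)] at h1
        apply hya α (hB hαB) hα1
        nth_rewrite 2 [← h1]
        group
      refine ⟨w' * b, B.mul_mem (hB' hw') (B.mul_mem (B.inv_mem hβB) hαB), insert α S,
        by rw [Finset.card_insert_of_notMem hαS, hSc], ?_, ?_, ?_⟩
      · intro a ha
        rcases Finset.mem_insert.1 ha with rfl | ha
        · exact ⟨hαB, hα1⟩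
        · exact ⟨hB' (hS1 a ha).1, (hS1 a ha).2⟩
      · intro a ha u hu
        have e : (w' * b)⁻¹ * u * (w' * b) = b⁻¹ * (w'⁻¹ * u * w') * b := by group
        rw [e]
        rcases Finset.mem_insert.1 ha with rfl | ha
        · have := mem_centralizer_iff.1 (hB'2 a hα hw') u hu
          have e2 : w'⁻¹ * u * w' = u := by rw [mul_assoc, this]; group
          rw [e2, hbα u hu]
        · rw [hS2 a ha u hu]
          exact hbS a ha _ (hZ a (hB (hB' (hS1 a ha).1)) (hS1 a ha).2 u hu)
      · rw [Finset.coe_insert, Set.injOn_insert (by simpa using hαS)]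
        refine ⟨hS3, ?_⟩
        rintro ⟨a, ha, he⟩
        exact hyne a ha he
    rcases hΓ2 α hα β hβ hne with h | h
    · exact key α hα β hβ hCαβ h
    · refine key β hβ α hα ?_ h
      have := C.inv_mem hCαβ
      simpa using this

/-- bound for abelian `p`-subgroups when `O_p = 1` -/
def cAb (m : ℕ) : ℕ := comb (m ^ m) (m + 1)

theorem abelian_bound {m : ℕ} (hm : 0 < m) (hyp : Hyp G m) (p : ℕ) [Fact p.Prime]
    (hO : Op p G = ⊥) (A : Subgroup G) (hAp : IsPGroup p A)
    (hA : ∀ a ∈ A, ∀ b ∈ A, a * b = b * a) : Nat.card A ≤ cAb m := by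
  by_contra hcon
  push Not at hcon
  have hdata : ∀ x : G, ∃ (Z : Subgroup G) (y : G), x ∈ A → x ≠ 1 →
      ((∀ u ∈ Z, x⁻¹ * u * x ∈ Z) ∧ y ∈ Z ∧ y * x ≠ x * y ∧
      (∀ B : Subgroup G, (∀ b ∈ B, b * x = x * b) → (centralizer (Z : Set G)).relIndex B ≤ m ^ m) ∧
      (∀ w, (∀ u ∈ Z, w⁻¹ * u * w = x⁻¹ * u * x) → ∀ R, IsRightEngelSink w⁻¹ R → y ∈ R)) := by
    intro x
    by_cases h : x ∈ A ∧ x ≠ 1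
    · have hxp : ∃ k, x ^ p ^ k = 1 := by
        obtain ⟨k, hk⟩ := hAp ⟨x, h.1⟩
        exact ⟨k, congrArg Subtype.val hk⟩
      obtain ⟨z, hz, hz1⟩ := baer p hxp (by rw [hO, mem_bot]; exact h.2)
      obtain ⟨Z, y, hZ⟩ := K2 hm hyp hz hz1
      exact ⟨Z, y, fun _ _ => hZ⟩
    · exact ⟨⊥, 1, fun h1 h2 => absurd ⟨h1, h2⟩ h⟩
  choose Z y hZy using hdata
  obtain ⟨w, hw, S, hSc, hS1, hS2, hS3⟩ := comb_lemma (Nat.pow_pos hm : 0 < m ^ m) A Z y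
    (fun a ha h1 => (hZy a ha h1).1) (fun a ha h1 => (hZy a ha h1).2.1)
    (fun a ha h1 => (hZy a ha h1).2.2.1)
    (fun a ha h1 B hB => (hZy a ha h1).2.2.2.1 B fun b hb => hA b (hB hb) a ha) (m + 1) A le_rfl hcon
  obtain ⟨R, hR, hRm⟩ := hyp w⁻¹
  have hsub : y '' S ⊆ R := by
    rintro _ ⟨a, ha, rfl⟩
    exact (hZy a (hS1 a ha).1 (hS1 a ha).2).2.2.2.2 w (hS2 a ha) R hR
  have := Set.ncard_le_ncard hsub
  rw [Set.ncard_image_of_injOn hS3, Set.ncard_coe_finset, hSc] at this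
  omega
end Comb

section C0
theorem self_centralizing (P : Type*) [Group P] [Finite P] [Group.IsNilpotent P] :
    ∃ A : Subgroup P, (∀ a ∈ A, ∀ b ∈ A, a * b = b * a) ∧ A.Normal ∧
      centralizer (A : Set P) ≤ A := by
  have hfin : {A : Subgroup P | (∀ a ∈ A, ∀ b ∈ A, a * b = b * a) ∧ A.Normal}.Finite := Set.toFinite _
  obtain ⟨A, ⟨hA1, hA2⟩, hAm⟩ := hfin.exists_maximal ⟨⊥, by simp, inferInstance⟩
  refine ⟨A, hA1, hA2, ?_⟩
  by_contra hcon
  classical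
  have hex : ∃ i, centralizer (A : Set P) ⊓ (⊤ : Subgroup P).lowerCentralSeries i ≤ A := by
    obtain ⟨n, hn⟩ := Subgroup.nilpotent_iff_lowerCentralSeries.1 (inferInstance : Group.IsNilpotent P)
    exact ⟨n, by rw [hn]; simp⟩
  obtain ⟨i, hi⟩ : ∃ i, Nat.find hex = i + 1 := by
    refine Nat.exists_eq_succ_of_ne_zero fun h => hcon ?_
    have := Nat.find_spec hex
    rw [h] at this
    simpa using this
  have hi1 := Nat.find_spec hex
  have hi2 := Nat.find_min hex (m := i) (by omega)
  rw [hi] at hi1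
  obtain ⟨x, ⟨hxC, hxL⟩, hxA⟩ := SetLike.not_le_iff_exists.1 hi2
  have hxC' := mem_centralizer_iff.1 hxC
  have hconj : ∀ g, ⁅x, g⁆ ∈ A := by
    intro g
    apply hi1
    refine ⟨?_, commutator_mem_commutator hxL (mem_top g)⟩
    rw [commutatorElement_def, mul_assoc, mul_assoc]
    refine mul_mem hxC ?_
    have : (centralizer (A : Set P)).Normal := inferInstance
    have := this.conj_mem _ (inv_mem hxC) g
    simpa [mul_assoc] using this
  have hcl : ∀ a ∈ insert x (A : Set P), ∀ b ∈ insert x (A : Set P), a * b = b * a := by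
    rintro a (rfl | ha) b (rfl | hb)
    · rfl
    · exact (hxC' b hb).symm
    · exact hxC' a ha
    · exact hA1 a ha b hb
  have hcomm : ∀ a ∈ closure (insert x (A : Set P)), ∀ b ∈ closure (insert x (A : Set P)), a * b = b * a := by
    have h1 : closure (insert x (A : Set P)) ≤ centralizer (insert x (A : Set P)) := by
      rw [closure_le]
      intro a ha
      exact mem_centralizer_iff.2 fun b hb => hcl b hb a ha
    intro a ha b hb
    rw [← centralizer_closure] at h1
    exact mem_centralizer_iff.1 (h1 hb) a ha
  have hnorm : (closure (insert x (A : Set P))).Normal := by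
    rw [← normalizer_eq_top_iff, eq_top_iff, le_normalizer_closure_iff]
    rintro g - a (rfl | ha)
    · have h1 : g * a * g⁻¹ = (⁅a, g⁆)⁻¹ * a := by rw [commutatorElement_def]; group
      rw [h1]
      exact mul_mem (inv_mem (subset_closure (Or.inr (hconj g)))) (subset_closure (Or.inl rfl))
    · exact subset_closure (Or.inr (hA2.conj_mem a ha g))
  have := hAm ⟨hcomm, hnorm⟩ ((Set.subset_insert x _).trans subset_closure)
  exact hxA (this (subset_closure (Or.inl rfl)))

theorem card_le_of_abelian (P : Type*) [Group P] [Finite P] [Group.IsNilpotent P] {c : ℕ}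
    (h : ∀ A : Subgroup P, (∀ a ∈ A, ∀ b ∈ A, a * b = b * a) → Nat.card A ≤ c) :
    Nat.card P ≤ c * c ^ c := by
  obtain ⟨A, hA, hn, hc⟩ := self_centralizing P
  have h1 := cent_index (⊤ : Subgroup P) (A : Set P) (A : Set P) fun b _ s hs => hn.conj_mem s hs b
  have hAc := h A hA
  have e : (A : Set P).ncard = Nat.card A := rfl
  rw [e] at h1
  have h2 := card_inf_mul_relIndex (centralizer (A : Set P)) ⊤
  rw [inf_top_eq, card_top] at h2
  rw [← h2]
  have hpos : 0 < c := lt_of_lt_of_le Nat.card_pos hAc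
  exact Nat.mul_le_mul ((Nat.card_le_card_of_injective _ (inclusion_injective hc)).trans hAc)
    (h1.trans (pow_le_self_pow hpos hAc hAc))

/-- bound for `|P : O_p|` -/
def c1 (m : ℕ) : ℕ := cAb m * cAb m ^ cAb m

theorem sylow_bound {G : Type*} [Group G] [Finite G] {m : ℕ} (hm : 0 < m) (hyp : Hyp G m) (p : ℕ)
    [Fact p.Prime] (P : Sylow p G) : Nat.card P ≤ c1 m * Nat.card (Op p G) := by
  set Q := (P : Subgroup G).map (QuotientGroup.mk' (Op p G)) with hQ
  have hQp : IsPGroup p Q := P.isPGroup'.map _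
  have : Group.IsNilpotent Q := hQp.isNilpotent
  have h1 : Nat.card Q ≤ c1 m := by
    refine card_le_of_abelian Q fun A hA => ?_
    have := abelian_bound hm (hyp.quot (Op p G)) p (Op_quot p) (A.map Q.subtype)
      ((hQp.to_subgroup A).map _) (by
        rintro _ ⟨a, ha, rfl⟩ _ ⟨b, hb, rfl⟩
        rw [← map_mul, ← map_mul, hA a ha b hb])
    rwa [card_map_of_injective Q.subtype_injective] at this
  have h2 := card_inf_mul_relIndex (Op p G) (P : Subgroup G)
  rw [inf_eq_left.2 (Op_le p P)] at h2
  have h3 := relIndex_ker (K := (P : Subgroup G)) (QuotientGroup.mk' (Op p G))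
  rw [QuotientGroup.ker_mk'] at h3
  have h4 : Nat.card P = Nat.card (P : Subgroup G) := rfl
  rw [h4, ← h2, h3, mul_comm]
  exact Nat.mul_le_mul_right _ h1
end C0
end EngelSink

namespace EngelSink
open Subgroup

section IDX
variable {G : Type*} [Group G] [Finite G]

theorem index_dvd (F : Subgroup G) (c : ℕ)
    (h : ∀ p : ℕ, p.Prime → ∃ H ≤ F, IsPGroup p H ∧ ∀ P : Sylow p G, Nat.card P ≤ c * Nat.card H) :
    F.index ∣ c.factorial := by
  rw [Nat.dvd_iff_prime_pow_dvd_dvd]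
  intro p k hp hk
  have := Fact.mk hp
  obtain ⟨H, hHF, hHp, hH⟩ := h p hp
  obtain ⟨P⟩ : Nonempty (Sylow p G) := inferInstance
  obtain ⟨j, hj⟩ := IsPGroup.iff_card.1 hHp
  have h1 : p ^ j ∣ Nat.card F := hj ▸ card_dvd_of_le hHF
  have h2 : p ^ (j + k) ∣ Nat.card G := by
    rw [pow_add, ← F.card_mul_index]
    exact mul_dvd_mul h1 hk
  have h3 : p ^ (j + k) ≤ Nat.card P := by
    rw [P.card_eq_multiplicity]
    exact Nat.pow_le_pow_right hp.pos ((hp.pow_dvd_iff_le_factorization Nat.card_pos.ne').1 h2)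
  have h4 := h3.trans (hH P)
  rw [hj, pow_add, mul_comm] at h4
  exact Nat.dvd_factorial (Nat.pow_pos hp.pos) (Nat.le_of_mul_le_mul_right h4 (Nat.pow_pos hp.pos))

theorem index_le (F : Subgroup G) (c : ℕ)
    (h : ∀ p : ℕ, p.Prime → ∃ H ≤ F, IsPGroup p H ∧ ∀ P : Sylow p G, Nat.card P ≤ c * Nat.card H) :
    F.index ≤ c.factorial := Nat.le_of_dvd (Nat.factorial_pos _) (index_dvd F c h)

/-- Fitting subgroup -/
def Fit (G : Type*) [Group G] : Subgroup G := ⨆ p : Nat.Primes, Op p G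

theorem Op_le_Fit (p : ℕ) (hp : p.Prime) : Op p G ≤ Fit G :=
  le_iSup (fun p : Nat.Primes => Op (p : ℕ) G) ⟨p, hp⟩

theorem Fit_index {m : ℕ} (hm : 0 < m) (hyp : Hyp G m) : (Fit G).index ≤ (c1 m).factorial := by
  apply index_le
  intro p hp
  have := Fact.mk hp
  exact ⟨Op p G, Op_le_Fit p hp, Op_isPGroup p, fun P => sylow_bound hm hyp p P⟩

theorem Fit_le (p : ℕ) [hp : Fact p.Prime] : Fit G ≤ Op p G ⊔ centralizer (Op p G : Set G) := by
  refine iSup_le fun q => ?_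
  have := Fact.mk q.2
  by_cases h : (q : ℕ) = p
  · rw [h]; exact le_sup_left
  · refine le_trans ?_ le_sup_right
    have hd := IsPGroup.disjoint_of_ne (p₁ := q) (p₂ := p) h (Op q G) (Op p G) (Op_isPGroup _) (Op_isPGroup _)
    intro x hx
    rw [mem_centralizer_iff]
    intro y hy
    exact (commute_of_normal_of_disjoint _ _ inferInstance inferInstance hd x y hx hy).symm.eq
end IDX

section C3

theorem per_theta {V : Type*} [CommGroup V] [Finite V] (σ : V →* V) (n : ℕ)
    (hn : ∀ v : V, v ^ n = 1 → v = 1) (v : V) (hv : ∏ i ∈ Finset.range n, σ^[i] v = 1) :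
    v ∈ Function.periodicPts (fun w : V => w⁻¹ * σ w) := by
  set τ : V → V := fun v => ∏ i ∈ Finset.range n, σ^[i] v with hτ
  have τmul : ∀ a b, τ (a * b) = τ a * τ b := by
    intro a b
    simp only [hτ]
    rw [← Finset.prod_mul_distrib]
    exact Finset.prod_congr rfl fun i _ => iterate_map_mul σ i a b
  have τinv : ∀ a, τ a⁻¹ = (τ a)⁻¹ := by
    intro a
    have h1 : τ 1 = 1 := by
      have := τmul 1 1
      simpa using this
    have := τmul a a⁻¹
    rw [mul_inv_cancel, h1] at this
    exact eq_inv_of_mul_eq_one_right this.symm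
  have τσ : ∀ a, τ (σ a) = σ (τ a) := by
    intro a
    simp only [hτ, map_prod]
    exact Finset.prod_congr rfl fun i _ => by
      rw [← Function.iterate_succ_apply, Function.iterate_succ_apply']
  set θ : V → V := fun w => w⁻¹ * σ w with hθ
  let V0 := {v : V // τ v = 1}
  let f : V0 → V0 := fun v => ⟨θ v.1, by
    simp only [hθ]; rw [τmul, τinv, τσ, v.2]; simp⟩
  have hinj : Function.Injective f := by
    rintro ⟨a, ha⟩ ⟨b, hb⟩ hab
    have h1 : a⁻¹ * σ a = b⁻¹ * σ b := congrArg Subtype.val hab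
    have hu : σ (a * b⁻¹) = a * b⁻¹ := by
      rw [map_mul, map_inv]
      rw [inv_mul_eq_iff_eq_mul] at h1
      rw [h1]
      rw [mul_assoc, mul_assoc, mul_inv_cancel, mul_one]
    have hτu : τ (a * b⁻¹) = (a * b⁻¹) ^ n := by
      simp only [hτ]
      rw [Finset.prod_congr rfl fun i _ => (Function.iterate_fixed hu i), Finset.prod_const, Finset.card_range]
    have : a * b⁻¹ = 1 := hn _ (by rw [← hτu, τmul, τinv, ha, hb]; simp)
    exact Subtype.ext (mul_inv_eq_one.1 this)
  obtain ⟨k, hk, h⟩ := hinj.mem_periodicPts ⟨v, hv⟩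
  refine ⟨k, hk, ?_⟩
  have hit : ∀ j (w : V0), (f^[j] w).1 = θ^[j] w.1 := by
    intro j w
    induction j with
    | zero => rfl
    | succ j ih => rw [Function.iterate_succ_apply', Function.iterate_succ_apply', ← ih]
  have := congrArg Subtype.val h
  rw [hit] at this
  exact this

variable {G : Type*} [Group G]

theorem per_Z [Finite G] (Z : Subgroup G) [hZ : Z.Normal] (hc : ∀ a ∈ Z, ∀ b ∈ Z, a * b = b * a)
    {x : G} {n : ℕ} (hx : x ^ n = 1) (hn : ∀ v ∈ Z, v ^ n = 1 → v = 1) {z : G} (hz : z ∈ Z)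
    (hxz : (x * z) ^ n = 1) : Per x (x * z * x⁻¹) := by
  let : CommGroup Z := { (inferInstance : Group Z) with
    mul_comm := fun a b => Subtype.ext (hc a a.2 b b.2) }
  let σ : Z →* Z :=
    { toFun := fun u => ⟨x⁻¹ * u * x, by simpa using hZ.conj_mem u u.2 x⁻¹⟩
      map_one' := by ext; simp
      map_mul' := fun a b => by
        apply Subtype.ext
        change x⁻¹ * ((a : G) * (b : G)) * x = (x⁻¹ * a * x) * (x⁻¹ * b * x)
        group }
  have hσ : ∀ u : Z, ((σ u : Z) : G) = x⁻¹ * u * x := fun u => rfl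
  have hpow : ∀ k, (x * z) ^ k = x ^ k * ((∏ i ∈ Finset.range k, σ^[i] ⟨z, hz⟩ : Z) : G) := by
    intro k
    induction k with
    | zero => simp
    | succ k ih =>
      have e : (∏ i ∈ Finset.range (k + 1), σ^[i] ⟨z, hz⟩ : Z) =
          σ (∏ i ∈ Finset.range k, σ^[i] ⟨z, hz⟩) * ⟨z, hz⟩ := by
        rw [Finset.prod_range_succ', map_prod]
        congr 1
        exact Finset.prod_congr rfl fun i _ => by rw [Function.iterate_succ_apply']
      have e2 : ((∏ i ∈ Finset.range (k + 1), σ^[i] ⟨z, hz⟩ : Z) : G) =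
        x⁻¹ * ((∏ i ∈ Finset.range k, σ^[i] ⟨z, hz⟩ : Z) : G) * x * z := by
        rw [e]; rfl
      rw [e2, pow_succ, ih, pow_succ]; group
  have hvm : x * z * x⁻¹ ∈ Z := hZ.conj_mem z hz x
  set v : Z := ⟨x * z * x⁻¹, hvm⟩ with hv
  have hσv : σ v = ⟨z, hz⟩ := by
    apply Subtype.ext; rw [hσ]; simp [hv, mul_assoc]
  have hσinj : Function.Injective σ := by
    intro a b hab
    have := congrArg Subtype.val hab
    rw [hσ, hσ] at this
    exact Subtype.ext (mul_left_cancel (mul_right_cancel this))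
  have htz : (∏ i ∈ Finset.range n, σ^[i] ⟨z, hz⟩ : Z) = 1 := by
    have := hpow n
    rw [hxz, hx, one_mul] at this
    exact Subtype.ext this.symm
  have htv : (∏ i ∈ Finset.range n, σ^[i] v : Z) = 1 := by
    apply hσinj
    rw [map_one, ← htz, map_prod]
    exact Finset.prod_congr rfl fun i _ => by
      rw [← hσv, ← Function.iterate_succ_apply, Function.iterate_succ_apply']
  obtain ⟨k, hk, h⟩ := per_theta σ n (fun u hu => Subtype.ext (hn u u.2 (congrArg Subtype.val hu))) v htv
  refine ⟨k, hk, ?_⟩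
  have hit : ∀ j (w : Z), (((fun w : Z => w⁻¹ * σ w)^[j] w : Z) : G) = (phi x)^[j] (w : G) := by
    intro j w
    induction j with
    | zero => rfl
    | succ j ih =>
      rw [Function.iterate_succ_apply', Function.iterate_succ_apply', ← ih, phi, mul_assoc, mul_assoc,
        ← mul_assoc _ _ x]
      rfl
  have := congrArg Subtype.val h
  rw [hit] at this
  exact this

theorem mem_sink_Z [Finite G] (Z : Subgroup G) [hZ : Z.Normal] (hc : ∀ a ∈ Z, ∀ b ∈ Z, a * b = b * a)
    {x : G} {n : ℕ} (hx : x ^ n = 1) (hn : ∀ v ∈ Z, v ^ n = 1 → v = 1) {z : G} (hz : z ∈ Z)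
    (hxz : (x * z) ^ n = 1) {R : Set G} (hR : IsRightEngelSink x⁻¹ R) : x * z * x⁻¹ ∈ R := by
  have hper := per_Z Z hc hx hn hz hxz
  apply sink_of_recurrent (x := x * z) hR
  have hmem : ∀ r, (phi x)^[r] (x * z * x⁻¹) ∈ Z := by
    intro r
    induction r with
    | zero => exact hZ.conj_mem z hz x
    | succ r ih =>
      rw [Function.iterate_succ_apply', phi, mul_assoc, mul_assoc, ← mul_assoc x⁻¹]
      exact Z.mul_mem (Z.inv_mem ih) (by simpa using hZ.conj_mem _ ih x⁻¹)
  have hit : ∀ r, (phi (x * z))^[r + 1] x⁻¹ = (phi x)^[r + 1] (x * z * x⁻¹) := by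
    intro r
    induction r with
    | zero => simp [phi, mul_assoc]
    | succ r ih =>
      rw [Function.iterate_succ_apply', ih, Function.iterate_succ_apply' _ (r + 1)]
      set u := (phi x)^[r + 1] (x * z * x⁻¹) with hu
      have h1 : x⁻¹ * u * x ∈ Z := by
        have hum : u ∈ Z := hmem (r + 1)
        clear_value u
        simpa using hZ.conj_mem u hum x⁻¹
      have h2 := hc _ h1 z hz
      calc phi (x * z) u = u⁻¹ * (z⁻¹ * ((x⁻¹ * u * x) * z)) := by rw [phi]; group
        _ = u⁻¹ * (z⁻¹ * (z * (x⁻¹ * u * x))) := by rw [h2]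
        _ = phi x u := by rw [phi]; group
  intro k
  obtain ⟨r, hr, h⟩ := hper.recurrent 0 (k + 1)
  obtain ⟨j, rfl⟩ := Nat.exists_eq_add_of_le hr
  refine ⟨k + j + 1, by omega, ?_⟩
  rw [hit]
  have e : k + j + 1 = k + 1 + j := by ring
  rw [e, h]; rfl

theorem pow_coprime_eq_one {p n : ℕ} (hpn : n.Coprime p) {v : G} (h1 : ∃ k, v ^ p ^ k = 1)
    (h2 : v ^ n = 1) : v = 1 := by
  obtain ⟨k, hk⟩ := h1
  have a := orderOf_dvd_of_pow_eq_one hk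
  have b := orderOf_dvd_of_pow_eq_one h2
  have : orderOf v ∣ 1 := by
    have := Nat.dvd_gcd b a
    rwa [Nat.Coprime.pow_right k hpn] at this
  exact orderOf_eq_one_iff.1 (Nat.dvd_one.1 this)

theorem conj_bound (p : ℕ) [Fact p.Prime] {m : ℕ} (hm : 0 < m) : ∀ N, ∀ (G : Type*) [Group G] [Finite G],
    Nat.card G = N → ∀ (P : Subgroup G), P.Normal → IsPGroup p P → ∀ (x : G) (n : ℕ), n.Coprime p → x ^ n = 1 →
    ∀ R : Set G, IsRightEngelSink x⁻¹ R → R.ncard ≤ m →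
    {b | ∃ a ∈ P, b = a * x * a⁻¹}.ncard ≤ m ^ R.ncard := by
  intro N
  induction N using Nat.strong_induction_on with
  | _ N ih =>
  intro G _ _ hN P hPn hPp x n hn hx R hR hRm
  by_cases hP : P = ⊥
  · have : {b | ∃ a ∈ P, b = a * x * a⁻¹} ⊆ {x} := by
      rintro _ ⟨a, ha, rfl⟩
      rw [hP, mem_bot] at ha
      subst ha; simp
    exact ((Set.ncard_le_ncard this).trans (by simp)).trans (Nat.one_le_pow _ _ hm)
  have : Nontrivial P := (nontrivial_iff_ne_bot P).2 hP
  set Z : Subgroup G := (center P).map P.subtype with hZ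
  have hZn : Z.Normal := inferInstanceAs ((center P).map P.subtype).Normal
  have hZP : Z ≤ P := by
    rw [hZ]; exact (map_subtype_le _)
  have hZc : ∀ a ∈ Z, ∀ b ∈ Z, a * b = b * a := by
    rintro _ ⟨a, ha, rfl⟩ _ ⟨b, hb, rfl⟩
    rw [← map_mul, ← map_mul]
    rw [(mem_center_iff.1 ha b)]
  have hZne : Z ≠ ⊥ := by
    have := IsPGroup.bot_lt_center hPp
    rw [hZ, Ne, map_eq_bot_iff_of_injective _ P.subtype_injective]
    exact this.ne'
  have hZtor : ∀ v ∈ Z, v ^ n = 1 → v = 1 := by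
    intro v hv h
    obtain ⟨k, hk⟩ := hPp ⟨v, hZP hv⟩
    exact pow_coprime_eq_one hn ⟨k, congrArg Subtype.val hk⟩ h
  set f := QuotientGroup.mk' Z with hf
  have hfs : Function.Surjective f := QuotientGroup.mk'_surjective Z
  have hcardlt : Nat.card (G ⧸ Z) < N := by
    rw [← hN, ← index_eq_card, ← Z.card_mul_index]
    have h1 : 1 < Nat.card Z := Z.one_lt_card_iff_ne_bot.2 hZne
    have h2 : 0 < Z.index := Nat.pos_of_ne_zero Z.index_ne_zero_of_finite
    nlinarith
  set X := {b | ∃ a ∈ P, b = a * x * a⁻¹} with hX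
  have ih' := ih _ hcardlt (G ⧸ Z) rfl (P.map f) (hPn.map f hfs) (hPp.map f) (f x) n hn
    (by rw [← map_pow, hx, map_one]) (f '' R) (by rw [← map_inv]; exact sink_map f hfs hR)
    ((Set.ncard_image_le (Set.toFinite _)).trans hRm)
  have hXim : {b | ∃ a ∈ P.map f, b = a * f x * a⁻¹} = f '' X := by
    ext b; constructor
    · rintro ⟨_, ⟨a, ha, rfl⟩, rfl⟩
      exact ⟨a * x * a⁻¹, ⟨a, ha, rfl⟩, by simp⟩
    · rintro ⟨_, ⟨a, ha, rfl⟩, rfl⟩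
      exact ⟨f a, ⟨a, ha, rfl⟩, by simp⟩
  rw [hXim] at ih'
  set Z0 : Set G := {z | z ∈ Z ∧ x * z ∈ X} with hZ0
  have hZ0R : ∀ z ∈ Z0, x * z * x⁻¹ ∈ R := by
    rintro z ⟨hz, a, ha, he⟩
    refine mem_sink_Z Z hZc hx hZtor hz ?_ hR
    rw [he, conj_pow, hx]; simp
  have hcinj : Function.Injective (fun z : G => x * z * x⁻¹) := fun a b h =>
    mul_left_cancel (mul_right_cancel h)
  have hZ0m : Z0.ncard ≤ m := by
    rw [← Set.ncard_image_of_injective Z0 hcinj]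
    refine (Set.ncard_le_ncard ?_).trans hRm
    rintro _ ⟨z, hz, rfl⟩; exact hZ0R z hz
  have hfib : X.ncard ≤ Z0.ncard * (f '' X).ncard := by
    classical
    have := Fintype.ofFinite G
    have h := Finset.card_le_mul_card_image (f := f) X.toFinset Z0.ncard (by
      intro b hb
      obtain ⟨b', hb', rfl⟩ := Finset.mem_image.1 hb
      obtain ⟨a, ha, rfl⟩ := Set.mem_toFinset.1 hb'
      rw [← Set.ncard_coe_finset]
      refine Set.ncard_le_ncard_of_injOn (fun y => x⁻¹ * (a⁻¹ * y * a)) ?_ ?_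
      · intro y hy
        rw [Finset.mem_coe, Finset.mem_filter, Set.mem_toFinset] at hy
        obtain ⟨⟨c, hc, rfl⟩, hy⟩ := hy
        refine ⟨?_, a⁻¹ * c, P.mul_mem (P.inv_mem ha) hc, by group⟩
        have : f (x⁻¹ * (a⁻¹ * (c * x * c⁻¹) * a)) = 1 := by
          rw [map_mul, map_mul, map_mul, hy]; simp only [map_mul, map_inv]; group
        exact (QuotientGroup.eq_one_iff _).1 this
      · intro y1 _ y2 _ h
        exact mul_left_cancel (mul_right_cancel (mul_left_cancel h)))
    have e1 : X.ncard = X.toFinset.card := Set.ncard_eq_toFinset_card' X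
    have e2 : (f '' X).ncard = (X.toFinset.image f).card := by
      rw [← Set.ncard_coe_finset]; simp
    rw [e1, e2]; exact h
  by_cases h1 : Z0.ncard ≤ 1
  · calc X.ncard ≤ Z0.ncard * (f '' X).ncard := hfib
      _ ≤ 1 * (f '' X).ncard := Nat.mul_le_mul_right _ h1
      _ ≤ m ^ (f '' R).ncard := by rw [one_mul]; exact ih'
      _ ≤ m ^ R.ncard := Nat.pow_le_pow_right hm (Set.ncard_image_le (Set.toFinite _))
  · push Not at h1
    obtain ⟨z1, hz1, z2, hz2, hne⟩ := (Set.one_lt_ncard_iff_nontrivial).1 h1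
    have hlt : (f '' R).ncard < R.ncard := by
      refine lt_of_le_of_ne (Set.ncard_image_le (Set.toFinite _)) fun h => ?_
      have hinj := Set.injOn_of_ncard_image_eq h (Set.toFinite _)
      refine hne (hcinj (hinj (hZ0R z1 hz1) (hZ0R z2 hz2) ?_))
      have hk : ∀ z ∈ Z0, f (x * z * x⁻¹) = 1 := fun z hz =>
        (QuotientGroup.eq_one_iff _).2 (hZn.conj_mem z hz.1 x)
      rw [hk z1 hz1, hk z2 hz2]
    calc X.ncard ≤ Z0.ncard * (f '' X).ncard := hfib
      _ ≤ m * m ^ (f '' R).ncard := Nat.mul_le_mul hZ0m ih'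
      _ = m ^ ((f '' R).ncard + 1) := by rw [pow_succ, mul_comm]
      _ ≤ m ^ R.ncard := Nat.pow_le_pow_right hm hlt
end C3
end EngelSink

namespace EngelSink
open Subgroup
open scoped commutatorElement

section Cp
variable {G : Type*} [Group G]

/-- elements of `O_p` centralized by all elements of order prime to p -/
def Cp (p : ℕ) (G : Type*) [Group G] : Subgroup G :=
  Op p G ⊓ centralizer {x : G | (orderOf x).Coprime p}

instance Cp_normal (p : ℕ) : (Cp p G).Normal := by
  have : (centralizer {x : G | (orderOf x).Coprime p}).Normal := by
    refine ⟨fun c hc g => ?_⟩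
    rw [mem_centralizer_iff] at hc ⊢
    intro x hx
    have h1 : g⁻¹ * x * g ∈ {x : G | (orderOf x).Coprime p} := by
      have : orderOf (g⁻¹ * x * g) = orderOf x := by
        have := orderOf_injective (MulAut.conj g⁻¹).toMonoidHom (MulAut.conj g⁻¹).injective x
        simpa using this
      rw [Set.mem_setOf_eq, this]; exact hx
    have := hc _ h1
    calc x * (g * c * g⁻¹) = g * ((g⁻¹ * x * g) * c) * g⁻¹ := by group
      _ = g * (c * (g⁻¹ * x * g)) * g⁻¹ := by rw [this]
      _ = _ := by group
  unfold Cp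
  infer_instance

theorem Cp_le (p : ℕ) : Cp p G ≤ Op p G := inf_le_left

theorem commute_of_pow {p n : ℕ} (hpn : n.Coprime p) {u c : G} (hu : ∃ k, u ^ p ^ k = 1)
    (h : u ^ n * c = c * u ^ n) : u * c = c * u := by
  obtain ⟨k, hk⟩ := hu
  have h1 : (Commute (u ^ n) c) := h
  have hcop : n.Coprime (orderOf u) :=
    Nat.Coprime.coprime_dvd_right (orderOf_dvd_of_pow_eq_one hk) (Nat.Coprime.pow_right k hpn)
  obtain ⟨j, hj⟩ := exists_pow_eq_self_of_coprime hcop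
  have := h1.pow_left j
  rw [hj] at this
  exact this

variable [Finite G]

theorem coset_centralizes (p : ℕ) [Fact p.Prime] {x x' c : G}
    (hF : x⁻¹ * x' ∈ Fit G) (hx' : (orderOf x').Coprime p) (hcO : c ∈ Op p G)
    (hc : c ∈ centralizer {b : G | ∃ a ∈ Op p G, b = a * x * a⁻¹}) : x' * c = c * x' := by
  set X := {b : G | ∃ a ∈ Op p G, b = a * x * a⁻¹} with hX
  have h1 := Fit_le p hF
  obtain ⟨u, hu, v, hv, huv⟩ := mem_sup_of_normal_left.1 h1
  have hx'e : x' = x * u * v := by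
    rw [mul_assoc, huv]; group
  have hnorm : ∀ d ∈ centralizer X, ∀ a ∈ Op p G, a * d * a⁻¹ ∈ centralizer X := by
    intro d hd a ha
    rw [mem_centralizer_iff] at hd ⊢
    rintro _ ⟨b, hb, rfl⟩
    have := hd (a⁻¹ * (b * x * b⁻¹) * a) ⟨a⁻¹ * b, mul_mem (inv_mem ha) hb, by group⟩
    calc (b * x * b⁻¹) * (a * d * a⁻¹) = a * ((a⁻¹ * (b * x * b⁻¹) * a) * d) * a⁻¹ := by group
      _ = a * (d * (a⁻¹ * (b * x * b⁻¹) * a)) * a⁻¹ := by rw [this]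
      _ = _ := by group
  have hxc : ∀ d ∈ centralizer X, x * d = d * x := by
    intro d hd
    exact mem_centralizer_iff.1 hd x ⟨1, one_mem _, by simp⟩
  have hact : ∀ d ∈ Op p G, d ∈ centralizer X → x' * d * x'⁻¹ = u * d * u⁻¹ := by
    intro d hdO hd
    have hv' := mem_centralizer_iff.1 hv d hdO
    have h2 := hxc _ (hnorm d hd u hu)
    calc x' * d * x'⁻¹ = x * (u * (v * d) * v⁻¹ * u⁻¹) * x⁻¹ := by rw [hx'e]; group
      _ = x * (u * d * u⁻¹) * x⁻¹ := by rw [← hv']; group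
      _ = _ := by rw [h2]; group
  have hit : ∀ k, x' ^ k * c * (x' ^ k)⁻¹ = u ^ k * c * (u ^ k)⁻¹ := by
    intro k
    induction k with
    | zero => simp
    | succ k ih =>
      have huk := pow_mem hu k
      have := hact (u ^ k * c * (u ^ k)⁻¹) (mul_mem (mul_mem huk hcO) (inv_mem huk)) (hnorm c hc _ huk)
      rw [← ih] at this
      calc x' ^ (k + 1) * c * (x' ^ (k + 1))⁻¹ = x' * (x' ^ k * c * (x' ^ k)⁻¹) * x'⁻¹ := by
            rw [pow_succ']; group
        _ = u * (x' ^ k * c * (x' ^ k)⁻¹) * u⁻¹ := this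
        _ = u * (u ^ k * c * (u ^ k)⁻¹) * u⁻¹ := by rw [ih]
        _ = _ := by rw [pow_succ']; group
  have hn := hit (orderOf x')
  rw [pow_orderOf_eq_one] at hn
  have hcu : u ^ orderOf x' * c = c * u ^ orderOf x' := by
    have : c = u ^ orderOf x' * c * (u ^ orderOf x')⁻¹ := by simpa using hn
    rw [eq_mul_inv_iff_mul_eq] at this
    exact this.symm
  have hup : ∃ k, u ^ p ^ k = 1 := by
    obtain ⟨k, hk⟩ := Op_isPGroup p (G := G) ⟨u, hu⟩
    exact ⟨k, congrArg Subtype.val hk⟩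
  have huc := commute_of_pow hx' hup hcu
  have := hact c hcO hc
  rw [huc, mul_inv_cancel_right, mul_inv_eq_iff_eq_mul] at this
  exact this

/-- bound for `|O_p : C_p|` -/
def c3 (m : ℕ) : ℕ := ((m ^ m) ^ (m ^ m)) ^ (c1 m).factorial

theorem Cp_relIndex {m : ℕ} (hm : 0 < m) (hyp : Hyp G m) (p : ℕ) [Fact p.Prime] :
    (Cp p G).relIndex (Op p G) ≤ c3 m := by
  classical
  have := Fintype.ofFinite (G ⧸ Fit G)
  have hrep : ∀ t : G ⧸ Fit G, ∃ S : Set G,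
      (centralizer S).relIndex (Op p G) ≤ (m ^ m) ^ (m ^ m) ∧
      ∀ x' : G, (QuotientGroup.mk x' : G ⧸ Fit G) = t → (orderOf x').Coprime p →
        ∀ c ∈ Op p G, c ∈ centralizer S → x' * c = c * x' := by
    intro t
    by_cases h : ∃ x : G, (QuotientGroup.mk x : G ⧸ Fit G) = t ∧ (orderOf x).Coprime p
    · obtain ⟨x, hxt, hx⟩ := h
      refine ⟨{b : G | ∃ a ∈ Op p G, b = a * x * a⁻¹}, ?_, ?_⟩
      · obtain ⟨R, hR, hRm⟩ := hyp x⁻¹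
        have hb := (conj_bound p hm _ G rfl (Op p G) inferInstance (Op_isPGroup p) x _ hx
          (pow_orderOf_eq_one x) R hR hRm).trans (Nat.pow_le_pow_right hm hRm)
        refine (cent_index (Op p G) _ {b : G | ∃ a ∈ Op p G, b = a * x * a⁻¹} ?_).trans
          (pow_le_self_pow (Nat.pow_pos hm) hb hb)
        rintro b hb _ ⟨a, ha, rfl⟩
        exact ⟨b * a, mul_mem hb ha, by group⟩
      · intro x' hx't hx' c hcO hc
        exact coset_centralizes p (QuotientGroup.eq.1 (hxt.trans hx't.symm)) hx' hcO hc
    · refine ⟨∅, ?_, fun x' h1 h2 => absurd ⟨x', h1, h2⟩ h⟩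
      have : centralizer (∅ : Set G) = ⊤ := by
        rw [eq_top_iff]; intro g _; rw [mem_centralizer_iff]; simp
      rw [this, relIndex_top_left]
      exact Nat.one_le_pow _ _ (Nat.pow_pos hm)
  choose S hS1 hS2 using hrep
  set D : Subgroup G := ⨅ t, centralizer (S t) with hD
  have hDidx : D.relIndex (Op p G) ≤ c3 m := by
    refine (relIndex_iInf_le _).trans ?_
    refine (Finset.prod_le_pow_card _ _ ((m ^ m) ^ (m ^ m)) fun t _ => hS1 t).trans ?_
    refine Nat.pow_le_pow_right (Nat.pow_pos (Nat.pow_pos hm)) ?_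
    rw [Finset.card_univ, ← Nat.card_eq_fintype_card, ← index_eq_card]
    exact Fit_index hm hyp
  have hle : D ⊓ Op p G ≤ Cp p G := by
    rintro c ⟨hcD, hcO⟩
    refine ⟨hcO, mem_centralizer_iff.2 fun x hx => ?_⟩
    exact hS2 (QuotientGroup.mk x) x rfl hx c hcO ((mem_iInf.1 hcD) _)
  rw [← inf_relIndex_right] at hDidx
  refine (relIndex_le_of_le_left hle ?_).trans hDidx
  exact index_ne_zero_of_finite

/-- bound for `|P : C_p|` -/
def c4 (m : ℕ) : ℕ := c1 m * c3 m

/-- the product of all `C_p` -/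
def F0 (G : Type*) [Group G] : Subgroup G := ⨆ p : Nat.Primes, Cp p G

/-- bound for the index of `F0` -/
def b2 (m : ℕ) : ℕ := (c4 m).factorial

theorem F0_index {m : ℕ} (hm : 0 < m) (hyp : Hyp G m) : (F0 G).index ≤ b2 m := by
  apply index_le
  intro p hp
  have := Fact.mk hp
  refine ⟨Cp p G, le_iSup (fun p : Nat.Primes => Cp (p : ℕ) G) ⟨p, hp⟩,
    (Op_isPGroup p).to_le (Cp_le p), fun P => ?_⟩
  have h1 := sylow_bound hm hyp p P
  have h2 := card_inf_mul_relIndex (Cp p G) (Op p G)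
  rw [inf_eq_left.2 (Cp_le p)] at h2
  have h3 := Cp_relIndex hm hyp p
  rw [← h2] at h1
  calc Nat.card P ≤ c1 m * (Nat.card (Cp p G) * (Cp p G).relIndex (Op p G)) := h1
    _ ≤ c1 m * (Nat.card (Cp p G) * c3 m) := by gcongr
    _ = _ := by rw [c4]; ring

theorem per_centralizes_Cp (p : ℕ) [Fact p.Prime] {x y : G} (h : Per x y) :
    y ∈ centralizer (Cp p G : Set G) := by
  set K := centralizer (Cp p G : Set G) with hK
  have hKn : K.Normal := inferInstance
  have hp : IsPGroup p (G ⧸ K) := by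
    intro g
    obtain ⟨g, rfl⟩ := QuotientGroup.mk_surjective g
    obtain ⟨k, n, hn, he⟩ := Nat.exists_eq_pow_mul_and_not_dvd (orderOf_pos g).ne' p
      (Fact.out : p.Prime).ne_one
    refine ⟨k, ?_⟩
    rw [← QuotientGroup.mk_pow, QuotientGroup.eq_one_iff, hK, mem_centralizer_iff]
    intro c hc
    refine ((mem_centralizer_iff.1 hc.2) (g ^ p ^ k) ?_).symm
    have : orderOf (g ^ p ^ k) = n := by
      rw [orderOf_pow_of_dvd (pow_ne_zero _ (Fact.out : p.Prime).ne_zero) (by rw [he]; exact dvd_mul_right _ _), he]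
      exact Nat.mul_div_cancel_left _ (Nat.pow_pos (Fact.out : p.Prime).pos)
    rw [Set.mem_setOf_eq, this]
    exact ((Nat.Prime.coprime_iff_not_dvd Fact.out).2 hn).symm
  have : Group.IsNilpotent (G ⧸ K) := hp.isNilpotent
  have h1 := (h.map (QuotientGroup.mk' K)).eq_one_of_nilpotent
  exact (QuotientGroup.eq_one_iff y).1 h1

theorem per_centralizes_F0 {x y : G} (h : Per x y) : F0 G ≤ centralizer {y} := by
  refine iSup_le fun p => ?_
  have := Fact.mk p.2
  intro c hc
  rw [mem_centralizer_singleton_iff]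
  exact ((mem_centralizer_iff.1 (per_centralizes_Cp p h)) c hc)
end Cp

section Final
variable {G : Type*} [Group G]

/-- subgroup generated by periodic points -/
def DD (G : Type*) [Group G] : Subgroup G := closure {y : G | ∃ x, Per x y}

theorem mem_DD {x y : G} (h : Per x y) : y ∈ DD G := subset_closure ⟨x, h⟩

instance DD_normal : (DD G).Normal := by
  rw [DD, ← normalizer_eq_top_iff, eq_top_iff, le_normalizer_closure_iff]
  rintro g - y ⟨x, h⟩
  refine subset_closure ⟨g * x * g⁻¹, ?_⟩
  simpa using h.map (MulAut.conj g).toMonoidHom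

theorem quot_DD_nilpotent [Finite G] : Group.IsNilpotent (G ⧸ DD G) := by
  refine ((Group.isNilpotent_of_finite_tfae (G := G ⧸ DD G)).out 0 3).2 ?_
  intro p _ P
  have hle : (P : Subgroup (G ⧸ DD G)) ≤ Op p (G ⧸ DD G) := by
    intro x hx
    by_contra hO
    obtain ⟨z, hz, hz1⟩ := baer p (a := x) (by
      obtain ⟨k, hk⟩ := P.isPGroup' ⟨x, hx⟩
      exact ⟨k, congrArg Subtype.val hk⟩) hO
    obtain ⟨a, rfl⟩ := QuotientGroup.mk'_surjective _ x
    obtain ⟨b, rfl⟩ := QuotientGroup.mk'_surjective _ z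
    obtain ⟨r, hr⟩ := exists_per a b
    have h1 : QuotientGroup.mk' (DD G) ((phi a)^[r] b) = 1 := (QuotientGroup.eq_one_iff _).2 (mem_DD hr)
    rw [map_phi_iter] at h1
    obtain ⟨s, hs, h⟩ := hz.recurrent 0 r
    obtain ⟨j, rfl⟩ := Nat.exists_eq_add_of_le hs
    rw [add_comm, Function.iterate_add_apply, h1, phi_iter_one] at h
    exact hz1 h.symm
  have : (P : Subgroup (G ⧸ DD G)) = Op p _ := le_antisymm hle (Op_le p P)
  rw [this]; infer_instance

theorem F0_centralizes_DD [Finite G] : F0 G ≤ centralizer (DD G : Set G) := by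
  rw [DD, centralizer_closure]
  intro f hf
  rw [mem_centralizer_iff]
  rintro y ⟨x, h⟩
  exact (mem_centralizer_singleton_iff.1 (per_centralizes_F0 h hf)).symm

/-- monotone version of Schur's bound -/
def schur (n : ℕ) : ℕ := (Finset.range (n + 1)).sup cardCommutatorBound

theorem commutatorSet_card [Finite G] : Nat.card (commutatorSet G) ≤ (center G).index * (center G).index := by
  rw [index_eq_card, ← Nat.card_prod]
  let f : (G ⧸ center G) × (G ⧸ center G) → G := fun q => ⁅q.1.out, q.2.out⁆
  have hsub : commutatorSet G ⊆ Set.range f := by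
    rintro _ ⟨a, b, rfl⟩
    refine ⟨(QuotientGroup.mk a, QuotientGroup.mk b), ?_⟩
    obtain ⟨⟨s, hs⟩, e1⟩ := QuotientGroup.mk_out_eq_mul (center G) a
    obtain ⟨⟨t, ht⟩, e2⟩ := QuotientGroup.mk_out_eq_mul (center G) b
    simp only at e1 e2
    simp only [f]
    rw [e1, e2, commutatorElement_def, commutatorElement_def]
    have hs' := mem_center_iff.1 hs
    have ht' := mem_center_iff.1 ht
    have h1 : a * s * (b * t) * (a * s)⁻¹ * (b * t)⁻¹ = a * (s * (b * t) * s⁻¹) * a⁻¹ * (b * t)⁻¹ := by group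
    rw [h1, ← hs' (b * t), mul_inv_cancel_right]
    have h2 : a * (b * t) * a⁻¹ * (b * t)⁻¹ = a * b * (t * a⁻¹) * t⁻¹ * b⁻¹ := by group
    rw [h2, ← ht']; group
  calc Nat.card (commutatorSet G) ≤ Nat.card (Set.range f) := Nat.card_mono (Set.toFinite _) hsub
    _ ≤ _ := Finite.card_range_le f

theorem commutator_card [Finite G] {B : ℕ} (hB : (center G).index ≤ B) :
    Nat.card (_root_.commutator G) ≤ schur (B * B) := by
  refine (card_commutator_le_of_finite_commutatorSet G).trans ?_
  refine Finset.le_sup (f := cardCommutatorBound) ?_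
  rw [Finset.mem_range]
  have := (commutatorSet_card (G := G)).trans (Nat.mul_le_mul hB hB)
  omega

theorem card_DD' [Finite G] {B : ℕ} (hB : (F0 G).index ≤ B) :
    Nat.card (⁅DD G, DD G⁆ : Subgroup G) ≤ schur (B * B) := by
  rw [← map_subtype_commutator, card_map_of_injective (DD G).subtype_injective]
  apply commutator_card
  have hle : (F0 G).subgroupOf (DD G) ≤ center (DD G) := by
    intro f hf
    rw [mem_center_iff]
    intro g
    exact Subtype.ext (mem_centralizer_iff.1 (F0_centralizes_DD hf) g g.2)
  refine le_trans ?_ hB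
  refine le_trans (index_antitone hle) ?_
  have h := relIndex_le_of_le_right (H := F0 G) (le_top : DD G ≤ ⊤)
    (by rw [relIndex_top_right]; exact index_ne_zero_of_finite)
  rwa [relIndex_top_right] at h

/-- periodic points in an abelian normal subgroup -/
def TT (D : Subgroup G) [hn : D.Normal] (hc : ∀ a ∈ D, ∀ b ∈ D, a * b = b * a) (x : G) :
    Subgroup G :=
  have hmem : ∀ a ∈ D, phi x a ∈ D := by
    intro a ha
    rw [phi, mul_assoc, mul_assoc, ← mul_assoc x⁻¹]
    exact D.mul_mem (D.inv_mem ha) (by simpa using hn.conj_mem _ ha x⁻¹)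
  have hmul : ∀ a ∈ D, ∀ b ∈ D, phi x (a * b) = phi x a * phi x b := by
    intro a ha b hb
    have h1 := hc _ (D.inv_mem hb) _ (hmem a ha)
    calc phi x (a * b) = (b⁻¹ * phi x a) * (x⁻¹ * b * x) := by simp only [phi]; group
      _ = _ := by rw [h1]; simp only [phi]; group
  have hitm : ∀ n, ∀ a ∈ D, (phi x)^[n] a ∈ D := by
    intro n a ha
    induction n with
    | zero => exact ha
    | succ n ih => rw [Function.iterate_succ_apply']; exact hmem _ ih
  have hit : ∀ n, ∀ a ∈ D, ∀ b ∈ D, (phi x)^[n] (a * b) = (phi x)^[n] a * (phi x)^[n] b := by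
    intro n a ha b hb
    induction n with
    | zero => rfl
    | succ n ih =>
      rw [Function.iterate_succ_apply', Function.iterate_succ_apply', Function.iterate_succ_apply', ih,
        hmul _ (hitm n a ha) _ (hitm n b hb)]
  { carrier := {d | d ∈ D ∧ Per x d}
    one_mem' := ⟨D.one_mem, 1, one_pos, phi_iter_one x 1⟩
    mul_mem' := by
      rintro a b ⟨ha, k, hk, hak⟩ ⟨hb, l, hl, hbl⟩
      refine ⟨D.mul_mem ha hb, k * l, Nat.mul_pos hk hl, ?_⟩
      have h1 := hak.mul_const l
      have h2 := hbl.const_mul k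
      exact (hit _ a ha b hb).trans (congrArg₂ (· * ·) h1 h2)
    inv_mem' := by
      rintro a ⟨ha, k, hk, hak⟩
      refine ⟨D.inv_mem ha, k, hk, ?_⟩
      have h1 := hit k a ha a⁻¹ (D.inv_mem ha)
      rw [mul_inv_cancel, phi_iter_one] at h1
      have h2 : (phi x)^[k] a = a := hak
      rw [h2] at h1
      exact (eq_inv_of_mul_eq_one_right h1.symm) }

theorem mem_TT {D : Subgroup G} [hn : D.Normal] {hc : ∀ a ∈ D, ∀ b ∈ D, a * b = b * a} {x d : G} :
    d ∈ TT D hc x ↔ d ∈ D ∧ Per x d := Iff.rfl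

theorem TT_card [Finite G] {m : ℕ} (hyp : Hyp G m) (D : Subgroup G) [hn : D.Normal]
    (hc : ∀ a ∈ D, ∀ b ∈ D, a * b = b * a) (x : G) : Nat.card (TT D hc x) ≤ m := by
  obtain ⟨R, hR, hRm⟩ := hyp x⁻¹
  refine le_trans ?_ hRm
  change (TT D hc x : Set G).ncard ≤ _
  refine Set.ncard_le_ncard_of_injOn (fun d => x * d * x⁻¹) ?_ ?_
  · rintro d ⟨hd, hper⟩
    have h1 := per_conj_mem_sink hper hR (c := 1) (by simp) 0
    have h2 := hc d hd _ (hn.conj_mem d hd x)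
    have e : 1 * (d * x * (phi x)^[0] d * (d * x)⁻¹) * 1⁻¹ = x * d * x⁻¹ := by
      calc _ = d * (x * d * x⁻¹) * d⁻¹ := by simp only [Function.iterate_zero, id]; group
        _ = _ := by rw [h2]; group
    rw [e] at h1
    exact h1
  · intro a _ b _ h
    exact mul_left_cancel (mul_right_cancel h)

theorem card_iSup_le [Finite G] {ι : Type*} [Finite ι] (D : Subgroup G)
    (hc : ∀ a ∈ D, ∀ b ∈ D, a * b = b * a) (H : ι → Subgroup G) (hH : ∀ i, H i ≤ D) {m : ℕ}
    (hm : ∀ i, Nat.card (H i) ≤ m) : Nat.card (⨆ i, H i : Subgroup G) ≤ m ^ Nat.card ι := by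
  classical
  have := Fintype.ofFinite ι
  have hcomm : Pairwise fun i j : ι => ∀ x y : G, x ∈ H i → y ∈ H j → Commute x y :=
    fun i j _ x y hx hy => hc x (hH i hx) y (hH j hy)
  rw [← noncommPiCoprod_range (hcomm := hcomm)]
  refine (Finite.card_range_le _).trans ?_
  rw [Nat.card_pi, Nat.card_eq_fintype_card, ← Finset.card_univ]
  exact Finset.prod_le_pow_card _ _ _ fun i _ => hm i

theorem per_coset [Finite G] {x f y : G} (hf : f ∈ F0 G) (h : Per x y) : Per (x * f) y := by
  have hfc := mem_centralizer_iff.1 (F0_centralizes_DD hf)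
  have hit : ∀ n, (phi (x * f))^[n] y = (phi x)^[n] y := by
    intro n
    induction n with
    | zero => rfl
    | succ n ih =>
      rw [Function.iterate_succ_apply', ih, Function.iterate_succ_apply']
      have hu : (phi x)^[n] y ∈ DD G := mem_DD (h.iter n)
      generalize (phi x)^[n] y = u at hu
      have h1 : x⁻¹ * u * x ∈ DD G := by
        simpa using (DD_normal (G := G)).conj_mem u hu x⁻¹
      calc phi (x * f) u = u⁻¹ * f⁻¹ * ((x⁻¹ * u * x) * f) := by rw [phi]; group
        _ = phi x u := by rw [hfc _ h1, phi]; group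
  obtain ⟨n, hn, hp⟩ := h
  exact ⟨n, hn, (hit n).trans hp⟩

/-- the final bound -/
def bound (m : ℕ) : ℕ := schur (b2 m * b2 m) * m ^ b2 m

theorem DD_card [Finite G] {m : ℕ} (hm : 0 < m) (hyp : Hyp G m) : Nat.card (DD G) ≤ bound m := by
  have hidx := F0_index hm hyp
  set D' : Subgroup G := ⁅DD G, DD G⁆ with hD'
  set f := QuotientGroup.mk' D' with hf
  have hfs : Function.Surjective f := QuotientGroup.mk'_surjective D'
  set D2 := (DD G).map f with hD2
  have hn : D2.Normal := (DD_normal (G := G)).map f hfs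
  have hc : ∀ a ∈ D2, ∀ b ∈ D2, a * b = b * a := by
    rintro _ ⟨a, ha, rfl⟩ _ ⟨b, hb, rfl⟩
    have h1 : f ⁅a, b⁆ = 1 := (QuotientGroup.eq_one_iff _).2 (commutator_mem_commutator ha hb)
    rw [map_commutatorElement, commutatorElement_eq_one_iff_mul_comm] at h1
    exact h1
  have hle : D2 ≤ ⨆ t : G ⧸ F0 G, TT D2 hc (f t.out) := by
    have e : D2 = closure (f '' {y | ∃ x, Per x y}) :=
      MonoidHom.map_closure f {y | ∃ x, Per x y}
    refine e.le.trans ((closure_le _).2 ?_)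
    rintro _ ⟨y, ⟨x, h⟩, rfl⟩
    refine (le_iSup (fun t : G ⧸ F0 G => TT D2 hc (f t.out)) (QuotientGroup.mk x)) ?_
    obtain ⟨⟨s, hs⟩, e1⟩ := QuotientGroup.mk_out_eq_mul (F0 G) x
    refine ⟨⟨y, mem_DD h, rfl⟩, ?_⟩
    rw [e1]
    exact (per_coset hs h).map f
  have h2 : Nat.card D2 ≤ m ^ b2 m := by
    refine (Nat.card_le_card_of_injective _ (inclusion_injective hle)).trans ?_
    refine (card_iSup_le D2 hc (fun t : G ⧸ F0 G => TT D2 hc (f t.out)) (fun t d hd => hd.1)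
      (fun t => TT_card (hyp.quot D') D2 hc _)).trans ?_
    rw [← index_eq_card]
    exact Nat.pow_le_pow_right hm hidx
  have h1 := card_DD' hidx
  have h3 := card_inf_mul_relIndex D' (DD G)
  rw [inf_eq_left.2 (commutator_le_self _)] at h3
  have h4 := relIndex_ker (K := DD G) f
  rw [hf, QuotientGroup.ker_mk'] at h4
  rw [← h3, h4]
  exact Nat.mul_le_mul h1 h2
end Final
end EngelSink

theorem stmt3 :
    ∃ f : ℕ → ℕ, ∀ (G : Type) (_ : Group G) (_ : Finite G) (m : ℕ), 0 < m →
      (∀ g : G, ∃ R : Set G, IsRightEngelSink g R ∧ R.ncard ≤ m) →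
      ∃ N : Subgroup G, ∃ _ : N.Normal,
        Nat.card N ≤ f m ∧ Group.IsNilpotent (G ⧸ N) := by
  refine ⟨EngelSink.bound, fun G _ _ m hm hyp => ⟨EngelSink.DD G, inferInstance, ?_, ?_⟩⟩
  · exact EngelSink.DD_card hm hyp
  · exact EngelSink.quot_DD_nilpotent
end
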